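/- arXiv:1905.06304 — 6 statements merged into one kernel-verified Lean document; each statement's English description precedes it below -/
import Mathlib

section
/- For all positive integers k and n, the number of gap-free partitions of n with smallest part k+1 equals the number of partitions of n in which the largest part appears exactly k+1 times and all remaining parts are distinct. -/
open Finset

noncomputable section

/-- The largest part of a partition (`0` for the empty partition). -/
def largestPart {n : ℕ} (π : n.Partition) : ℕ := π.parts.sup

/-- The smallest part of a partition (`0` for the empty partition). -/
def smallestPart {n : ℕ} (π : n.Partition) : ℕ := sInf {a | a ∈ π.parts}

/-- A partition is gap-free if every integer strictly between its smallest part and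
its largest part is also a part. -/
def GapFree {n : ℕ} (π : n.Partition) : Prop :=
  ∀ j, smallestPart π < j → j < largestPart π → j ∈ π.parts

/-- The number of parts of a partition that are larger than `i`. -/
def numPartsGt {n : ℕ} (π : n.Partition) (i : ℕ) : ℕ := π.parts.countP (i < ·)

theorem sum_range_countP_lt (s : Multiset ℕ) (N : ℕ) (h : ∀ a ∈ s, a ≤ N) :
    ∑ i ∈ range N, s.countP (i < ·) = s.sum := by
  induction s using Multiset.induction_on with
  | empty => simp
  | cons a s ih =>
    have ha : a ≤ N := h a (Multiset.mem_cons_self a s)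
    have hcard : #{i ∈ range N | i < a} = a := by
      rw [show {i ∈ range N | i < a} = range a by ext; simp; omega, card_range]
    simp only [Multiset.countP_cons, sum_add_distrib, Multiset.sum_cons,
      ih fun b hb => h b (Multiset.mem_cons_of_mem hb), ← card_filter, hcard]
    exact add_comm _ _

theorem Nat.Partition.le_of_mem {n a : ℕ} (π : n.Partition) (ha : a ∈ π.parts) : a ≤ n :=
  (Multiset.single_le_sum (fun _ _ => Nat.zero_le _) a ha).trans_eq π.parts_sum

/-- The conjugate partition, whose parts are the positive values of `numPartsGt`. -/
def conjugate {n : ℕ} (π : n.Partition) : n.Partition :=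
  Nat.Partition.ofSums n ((range n).val.map (numPartsGt π))
    ((sum_range_countP_lt π.parts n fun _ => π.le_of_mem).trans π.parts_sum)

section numPartsGt

variable {n : ℕ} (π : n.Partition)

theorem numPartsGt_antitone : Antitone (numPartsGt π) := fun _ _ hij => by
  simp only [numPartsGt, Multiset.countP_eq_card_filter]
  exact Multiset.card_le_card (Multiset.monotone_filter_right _ fun _ h => hij.trans_lt h)

theorem numPartsGt_pos {i : ℕ} : 0 < numPartsGt π i ↔ ∃ a ∈ π.parts, i < a :=
  Multiset.countP_pos

theorem numPartsGt_eq_add_count (i : ℕ) :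
    numPartsGt π i = numPartsGt π (i + 1) + π.parts.count (i + 1) := by
  unfold numPartsGt
  induction π.parts using Multiset.induction_on with
  | empty => simp
  | cons a s ih =>
    simp only [Multiset.countP_cons, Multiset.count_cons, ih]
    split_ifs <;> omega

theorem lt_largestPart_iff {i : ℕ} : i < largestPart π ↔ 0 < numPartsGt π i := by
  rw [numPartsGt_pos, largestPart, ← not_le, Multiset.sup_le]
  push Not
  rfl

theorem numPartsGt_conjugate (j : ℕ) :
    numPartsGt (conjugate π) j = #{i ∈ range n | j < numPartsGt π i} := by
  have h : numPartsGt (conjugate π) j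
      = (((range n).val.map (numPartsGt π)).filter (· ≠ 0)).countP (j < ·) := rfl
  rw [h, Multiset.countP_filter, Multiset.countP_map, card_def, filter_val]
  congr 1
  refine Multiset.filter_congr fun i _ => ?_
  omega

theorem lt_numPartsGt_conjugate {i j : ℕ} :
    i < numPartsGt (conjugate π) j ↔ j < numPartsGt π i := by
  rw [numPartsGt_conjugate]
  constructor
  · intro h
    by_contra hj
    have hsub : {l ∈ range n | j < numPartsGt π l} ⊆ range i := fun l hl => by
      rw [mem_range]
      by_contra hil
      have := numPartsGt_antitone π (not_lt.mp hil)
      have := (mem_filter.mp hl).2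
      omega
    have := card_le_card hsub
    rw [card_range] at this
    omega
  · intro h
    obtain ⟨a, ha, hia⟩ := (numPartsGt_pos π).mp (Nat.zero_lt_of_lt h)
    have han := π.le_of_mem ha
    have hsub : range (i + 1) ⊆ {l ∈ range n | j < numPartsGt π l} := fun l hl => by
      rw [mem_range] at hl
      exact mem_filter.mpr ⟨mem_range.mpr (by omega),
        h.trans_le (numPartsGt_antitone π (by omega))⟩
    simpa [Nat.succ_le_iff] using card_le_card hsub

theorem numPartsGt_injective : Function.Injective (numPartsGt (n := n)) := by
  intro π ρ h
  refine Nat.Partition.ext (Multiset.ext.mpr fun a => ?_)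
  cases a with
  | zero =>
    rw [Multiset.count_eq_zero_of_notMem fun h0 => (π.parts_pos h0).ne rfl,
      Multiset.count_eq_zero_of_notMem fun h0 => (ρ.parts_pos h0).ne rfl]
  | succ i =>
    have h1 := numPartsGt_eq_add_count π i
    have h2 := numPartsGt_eq_add_count ρ i
    rw [h] at h1
    omega

theorem conjugate_involutive : Function.Involutive (conjugate (n := n)) := fun π =>
  numPartsGt_injective <| funext fun i => eq_of_forall_lt_iff fun j => by
    rw [lt_numPartsGt_conjugate, lt_numPartsGt_conjugate]

theorem succ_mem_parts_iff {i : ℕ} :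
    i + 1 ∈ π.parts ↔ numPartsGt π (i + 1) < numPartsGt π i := by
  rw [← Multiset.count_pos, numPartsGt_eq_add_count π i]
  omega

theorem smallestPart_eq_succ_iff {k : ℕ} :
    smallestPart π = k + 1 ↔
      numPartsGt π 0 = numPartsGt π k ∧ numPartsGt π (k + 1) < numPartsGt π k := by
  rw [← succ_mem_parts_iff]
  constructor
  · intro h
    have hmem : smallestPart π ∈ π.parts := Nat.sInf_mem (s := {a | a ∈ π.parts}) <| by
      by_contra hne
      rw [Set.not_nonempty_iff_eq_empty] at hne
      simp [smallestPart, hne] at h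
    refine ⟨?_, h ▸ hmem⟩
    refine Multiset.countP_congr rfl fun a ha => ?_
    have : smallestPart π ≤ a := Nat.sInf_le (s := {a | a ∈ π.parts}) ha
    simp only [eq_iff_iff]
    omega
  · rintro ⟨h, hmem⟩
    refine le_antisymm (Nat.sInf_le (s := {a | a ∈ π.parts}) hmem) ?_
    refine le_csInf ⟨_, hmem⟩ fun a ha => ?_
    by_contra! hak
    have hpos := π.parts_pos ha
    obtain ⟨i, rfl⟩ := Nat.exists_eq_succ_of_ne_zero hpos.ne'
    have h1 := (succ_mem_parts_iff π).mp ha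
    have h2 := numPartsGt_antitone π (Nat.zero_le i)
    have h3 := numPartsGt_antitone π (show i + 1 ≤ k by omega)
    omega

theorem gapFree_and_smallestPart_iff {k : ℕ} :
    GapFree π ∧ smallestPart π = k + 1 ↔
      0 < numPartsGt π 0 ∧ numPartsGt π 0 = numPartsGt π k ∧
        ∀ j, k ≤ j → 0 < numPartsGt π j → numPartsGt π (j + 1) < numPartsGt π j := by
  rw [smallestPart_eq_succ_iff]
  constructor
  · rintro ⟨hgap, h0, hk⟩
    refine ⟨by omega, h0, fun j hkj hj => ?_⟩
    rcases hkj.eq_or_lt with rfl | hkj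
    · exact hk
    rcases Nat.eq_zero_or_pos (numPartsGt π (j + 1)) with hz | hz
    · omega
    · refine (succ_mem_parts_iff π).mp (hgap _ ?_ ((lt_largestPart_iff π).mpr hz))
      rw [(smallestPart_eq_succ_iff π).mpr ⟨h0, hk⟩]
      omega
  · rintro ⟨hpos, h0, h⟩
    have hk := h k le_rfl (h0 ▸ hpos)
    refine ⟨fun j hj hjl => ?_, h0, hk⟩
    rw [(smallestPart_eq_succ_iff π).mpr ⟨h0, hk⟩] at hj
    obtain ⟨i, rfl⟩ := Nat.exists_eq_succ_of_ne_zero (show j ≠ 0 by omega)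
    exact (succ_mem_parts_iff π).mpr
      (h i (by omega) ((lt_largestPart_iff π).mp (by omega)))

theorem count_largestPart_and_distinct_iff {k : ℕ} :
    (π.parts.count (largestPart π) = k + 1 ∧
        ∀ p ∈ π.parts, p ≠ largestPart π → π.parts.count p = 1) ↔
      0 < numPartsGt π 0 ∧
        (∀ i, 0 < numPartsGt π i → numPartsGt π (i + 1) = 0 → numPartsGt π i = k + 1) ∧
        ∀ i, 0 < numPartsGt π (i + 1) → numPartsGt π i ≤ numPartsGt π (i + 1) + 1 := by
  constructor
  · rintro ⟨hL, hd⟩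
    have hmem : largestPart π ∈ π.parts := Multiset.count_pos.mp (by omega)
    refine ⟨(lt_largestPart_iff π).mp (π.parts_pos hmem), fun i hi hi' => ?_, fun i hi => ?_⟩
    · have h1 := (lt_largestPart_iff π).mpr hi
      have h2 := (lt_largestPart_iff π (i := i + 1)).not.mpr (by omega)
      rw [numPartsGt_eq_add_count, hi', show i + 1 = largestPart π by omega, hL, zero_add]
    · have h1 := (lt_largestPart_iff π).mpr hi
      rw [numPartsGt_eq_add_count π i]
      by_cases hm : i + 1 ∈ π.parts
      · rw [hd _ hm h1.ne]
      · rw [Multiset.count_eq_zero_of_notMem hm]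
        omega
  · rintro ⟨h0, hL, hd⟩
    constructor
    · obtain ⟨l, hl⟩ := Nat.exists_eq_succ_of_ne_zero ((lt_largestPart_iff π).mpr h0).ne'
      have h1 := (lt_largestPart_iff π (i := l)).mp (by omega)
      have h2 := (lt_largestPart_iff π (i := l + 1)).not.mp (by omega)
      have h3 := hL l h1 (by omega)
      have h4 := numPartsGt_eq_add_count π l
      rw [hl, Nat.succ_eq_add_one]
      omega
    · intro p hp hne
      obtain ⟨i, rfl⟩ := Nat.exists_eq_succ_of_ne_zero (π.parts_pos hp).ne'
      have hle : i + 1 ≤ largestPart π := Multiset.le_sup hp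
      have h1 := hd i ((lt_largestPart_iff π).mp (by omega))
      have h2 := numPartsGt_eq_add_count π i
      have h3 := Multiset.count_pos.mpr hp
      rw [Nat.succ_eq_add_one] at *
      omega

end numPartsGt

theorem gapFree_iff_conjugate {n : ℕ} (π : n.Partition) (k : ℕ) :
    GapFree π ∧ smallestPart π = k + 1 ↔
      (conjugate π).parts.count (largestPart (conjugate π)) = k + 1 ∧
        ∀ p ∈ (conjugate π).parts, p ≠ largestPart (conjugate π) →
          (conjugate π).parts.count p = 1 := by
  rw [gapFree_and_smallestPart_iff, count_largestPart_and_distinct_iff]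
  have gal (i j : ℕ) := lt_numPartsGt_conjugate π (i := i) (j := j)
  have anti := numPartsGt_antitone π
  have anti' := numPartsGt_antitone (conjugate π)
  generalize numPartsGt (conjugate π) = g at *
  generalize numPartsGt π = f at *
  refine and_congr (gal 0 0).symm ⟨?_, ?_⟩
  · rintro ⟨h0, hf⟩
    have hg (i : ℕ) (hi : 0 < g i) : k < g i := by
      rw [gal] at hi ⊢
      omega
    refine ⟨fun i hi hi' => ?_, fun i hi => ?_⟩
    · have h1 := hg i hi
      by_contra hne
      have h2 := (gal (k + 1) i).mp (by omega)
      have h3 := (gal k (i + 1)).not.mp (by omega)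
      have h4 := hf k le_rfl (by have := anti (Nat.le_add_right k 1); omega)
      omega
    · have h1 := hg _ hi
      by_contra! hlt
      have h2 := (gal (g (i + 1) + 1) i).mp hlt
      have h3 := (gal (g (i + 1)) (i + 1)).not.mp (lt_irrefl _)
      have h4 := anti (Nat.le_add_right (g (i + 1)) 1)
      have h5 := hf (g (i + 1)) h1.le (by omega)
      omega
  · rintro ⟨hL, hd⟩
    have hg (m i : ℕ) (hm : k ≤ m) (hi : m + 1 < g i) : m < g (i + 1) := by
      rcases Nat.eq_zero_or_pos (g (i + 1)) with hz | hz
      · have := hL i (by omega) hz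
        omega
      · have := hd i hz
        omega
    have hk (i : ℕ) (hi : 0 < g i) : k < g i := by
      obtain ⟨d, hd⟩ : ∃ d, d = f 0 - i := ⟨_, rfl⟩
      induction d generalizing i with
      | zero =>
        rw [gal] at hi
        omega
      | succ d ih =>
        rcases Nat.eq_zero_or_pos (g (i + 1)) with hz | hz
        · have := hL i hi hz
          omega
        · exact (ih (i + 1) hz (by omega)).trans_le (anti' (Nat.le_succ i))
    refine ⟨le_antisymm ?_ (anti (Nat.zero_le k)), fun j hkj hj => ?_⟩
    · by_contra! hlt
      exact lt_irrefl _ ((gal _ _).mp (hk _ ((gal _ _).mpr hlt)))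
    · by_contra! hle
      obtain ⟨i, hi⟩ := Nat.exists_eq_succ_of_ne_zero hj.ne'
      have h1 := hg j i hkj ((gal _ _).mpr (by omega))
      have h2 := (gal _ _).mp h1
      omega

/-- For positive integers `k` and `n`, the number of gap-free
partitions of `n` with smallest part `k+1` equals the number of partitions of `n` in
which the largest part appears exactly `k+1` times and all remaining parts are distinct. -/
theorem gapFree_count_eq (k n : ℕ) (hk : 0 < k) (hn : 0 < n) :
    Nat.card {π : n.Partition // GapFree π ∧ smallestPart π = k + 1} =
      Nat.card {π : n.Partition //
        π.parts.count (largestPart π) = k + 1 ∧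
        ∀ p ∈ π.parts, p ≠ largestPart π → π.parts.count p = 1} :=
  Nat.card_congr <| conjugate_involutive.toPerm.subtypeEquiv fun π => gapFree_iff_conjugate π k
end
end

section
/- Let g(k,n) denote the number of partitions of n whose maximal excludant equals k. Then for all positive integers k and n, g(k,n) = ∑_{a+b=n, a≥0, b≥1} p_{≤k−1}(a) · G_{k+1}(b), where p_{≤k−1}(a) is the number of partitions of a all of whose parts are at most k−1 (with p_{≤k−1}(0)=1) and G_{k+1}(b) is the number of gap-free partitions of b with smallest part k+1. -/
open Finset

noncomputable section

/-- The maximal excludant of a partition: the largest nonnegative integer smaller than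
the largest part that is not a part. -/
def maex {n : ℕ} (π : n.Partition) : ℕ :=
  Nat.findGreatest (fun j => j ∉ π.parts) (largestPart π - 1)

/-- `g k n`: the number of partitions of `n` whose maximal excludant equals `k`. -/
def g (k n : ℕ) : ℕ := Nat.card {π : n.Partition // maex π = k}

/-- `p_{≤k}(a)`: the number of partitions of `a` all of whose parts are at most `k`
(so `p_{≤k}(0) = 1`, counting the empty partition). -/
def pLe (k a : ℕ) : ℕ := Nat.card {π : a.Partition // ∀ p ∈ π.parts, p ≤ k}

/-- `G_s(b)`: the number of gap-free partitions of `b` with smallest part `s`. -/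
def Ggap (s b : ℕ) : ℕ := Nat.card {π : b.Partition // GapFree π ∧ smallestPart π = s}

lemma lt_largestPart_iff_s9 {m n : ℕ} (π : n.Partition) :
    m < largestPart π ↔ ∃ x ∈ π.parts, m < x := by
  rw [← not_le, largestPart, Multiset.sup_le]
  push Not
  rfl

lemma maex_eq_iff {k n : ℕ} (hk : 0 < k) (π : n.Partition) :
    maex π = k ↔ k ∉ π.parts ∧ (∃ x ∈ π.parts, k < x) ∧
      ∀ x ∈ π.parts, ∀ j, k < j → j < x → j ∈ π.parts := by
  rw [maex, Nat.findGreatest_eq_iff]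
  constructor
  · rintro ⟨hle, hmem, hgap⟩
    have hkl : k < largestPart π := by omega
    refine ⟨hmem hk.ne', (lt_largestPart_iff_s9 π).1 hkl, fun x hx j hkj hjx => ?_⟩
    have : j < largestPart π := (lt_largestPart_iff_s9 π).2 ⟨x, hx, hjx⟩
    exact not_not.1 (hgap hkj (by omega))
  · rintro ⟨hmem, hex, hgap⟩
    have hkl := (lt_largestPart_iff_s9 π).2 hex
    refine ⟨by omega, fun _ => hmem, fun j hkj hjl => ?_⟩
    obtain ⟨x, hx, hjx⟩ := (lt_largestPart_iff_s9 π).1 (show j < largestPart π by omega)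
    exact not_not.2 (hgap x hx j hkj hjx)

lemma gapFree_and_smallestPart_eq_succ_iff {k n : ℕ} (π : n.Partition) :
    GapFree π ∧ smallestPart π = k + 1 ↔ (∃ x, x ∈ π.parts) ∧ (∀ x ∈ π.parts, k < x) ∧
      ∀ x ∈ π.parts, ∀ j, k < j → j < x → j ∈ π.parts := by
  constructor
  · rintro ⟨hgap, hs⟩
    have hne : {a | a ∈ π.parts}.Nonempty := by
      refine Nat.nonempty_of_pos_sInf ?_
      change 0 < smallestPart π
      omega
    have hmin : k + 1 ∈ π.parts := hs ▸ Nat.sInf_mem hne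
    refine ⟨hne, fun x hx => ?_, fun x hx j hkj hjx => ?_⟩
    · have : smallestPart π ≤ x := Nat.sInf_le hx
      omega
    · rcases Nat.eq_or_lt_of_le (Nat.succ_le_of_lt hkj) with rfl | h
      · exact hmin
      · exact hgap j (hs ▸ h) ((lt_largestPart_iff_s9 π).2 ⟨x, hx, hjx⟩)
  · rintro ⟨⟨x, hx⟩, hlow, hgap⟩
    have hmin : k + 1 ∈ π.parts := by
      rcases Nat.eq_or_lt_of_le (Nat.succ_le_of_lt (hlow x hx)) with rfl | h
      · exact hx
      · exact hgap x hx _ k.lt_succ_self h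
    have hs : smallestPart π = k + 1 :=
      le_antisymm (Nat.sInf_le hmin) (hlow _ (Nat.sInf_mem (s := {a | a ∈ π.parts}) ⟨x, hx⟩))
    refine ⟨fun j hj hjl => ?_, hs⟩
    obtain ⟨y, hy, hjy⟩ := (lt_largestPart_iff_s9 π).1 hjl
    exact hgap y hy j (by omega) hjy

/-- The partition whose parts are those of two given partitions together. -/
def unionParts {a b n : ℕ} (h : a + b = n) (σ : a.Partition) (τ : b.Partition) :
    n.Partition where
  parts := σ.parts + τ.parts
  parts_pos hi := (Multiset.mem_add.1 hi).elim σ.parts_pos τ.parts_pos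
  parts_sum := by rw [Multiset.sum_add, σ.parts_sum, τ.parts_sum, h]

/-- The partition formed by the parts of `π` satisfying `p`. -/
def filterParts {n : ℕ} (π : n.Partition) (p : ℕ → Prop) [DecidablePred p] :
    (π.parts.filter p).sum.Partition where
  parts := π.parts.filter p
  parts_pos hi := π.parts_pos (Multiset.mem_of_mem_filter hi)
  parts_sum := rfl

lemma maex_unionParts {k a b n : ℕ} (hk : 0 < k) (h : a + b = n) {σ : a.Partition}
    {τ : b.Partition} (hσ : ∀ p ∈ σ.parts, p ≤ k - 1)
    (hτ : GapFree τ ∧ smallestPart τ = k + 1) : maex (unionParts h σ τ) = k := by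
  obtain ⟨⟨x, hx⟩, hlow, hgap⟩ := (gapFree_and_smallestPart_eq_succ_iff τ).1 hτ
  rw [maex_eq_iff hk]
  simp only [unionParts, Multiset.mem_add]
  refine ⟨?_, ⟨x, Or.inr hx, hlow x hx⟩, ?_⟩
  · rintro (h | h)
    · have := hσ k h
      omega
    · exact (hlow k h).false
  · rintro y (hy | hy) j hkj hjy
    · have := hσ y hy
      omega
    · exact Or.inr (hgap y hy j hkj hjy)

lemma filter_lt_add {k : ℕ} {s t : Multiset ℕ} (hs : ∀ x ∈ s, x ≤ k) (ht : ∀ x ∈ t, k < x) :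
    (s + t).filter (k < ·) = t := by
  rw [Multiset.filter_add, Multiset.filter_eq_nil.2 fun x hx => (hs x hx).not_gt,
    Multiset.filter_eq_self.2 ht, zero_add]

/-- For positive integers `k` and `n`,
`g(k,n) = ∑_{a+b=n, b≥1} p_{≤k−1}(a) · G_{k+1}(b)`. -/
theorem g_eq_sum (k n : ℕ) (hk : 0 < k) (hn : 0 < n) :
    g k n =
      ∑ ab ∈ (antidiagonal n).filter (fun ab => 1 ≤ ab.2),
        pLe (k - 1) ab.1 * Ggap (k + 1) ab.2 := by
  let merge : (Σ ab : {ab // ab ∈ (antidiagonal n).filter (fun ab => 1 ≤ ab.2)},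
      {σ : ab.1.1.Partition // ∀ p ∈ σ.parts, p ≤ k - 1} ×
        {τ : ab.1.2.Partition // GapFree τ ∧ smallestPart τ = k + 1}) →
      {π : n.Partition // maex π = k} := fun x =>
    have hab := mem_antidiagonal.1 (mem_filter.1 x.1.2).1
    ⟨unionParts hab x.2.1.1 x.2.2.1, maex_unionParts hk hab x.2.1.2 x.2.2.2⟩
  have hbij : Function.Bijective merge := by
    constructor
    · rintro ⟨⟨⟨a, b⟩, hab⟩, ⟨σ, hσ⟩, ⟨τ, hτ⟩⟩ ⟨⟨⟨a', b'⟩, hab'⟩, ⟨σ', hσ'⟩, ⟨τ', hτ'⟩⟩ h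
      have hparts : σ.parts + τ.parts = σ'.parts + τ'.parts :=
        congrArg (fun π => π.1.parts) h
      have hlow := ((gapFree_and_smallestPart_eq_succ_iff τ).1 hτ).2.1
      have hlow' := ((gapFree_and_smallestPart_eq_succ_iff τ').1 hτ').2.1
      have hττ : τ.parts = τ'.parts := by
        rw [← filter_lt_add (fun x hx => (hσ x hx).trans (k.sub_le 1)) hlow, hparts,
          filter_lt_add (fun x hx => (hσ' x hx).trans (k.sub_le 1)) hlow']
      have hσσ : σ.parts = σ'.parts := by
        rw [hττ] at hparts
        exact add_right_cancel hparts
      obtain rfl : a = a' := σ.parts_sum.symm.trans (hσσ ▸ σ'.parts_sum)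
      obtain rfl : b = b' := τ.parts_sum.symm.trans (hττ ▸ τ'.parts_sum)
      obtain rfl := Nat.Partition.ext hσσ
      obtain rfl := Nat.Partition.ext hττ
      rfl
    · rintro ⟨π, hπ⟩
      obtain ⟨hmem, ⟨x, hx, hkx⟩, hgap⟩ := (maex_eq_iff hk π).1 hπ
      have hsplit : π.parts.filter (¬ k < ·) + π.parts.filter (k < ·) = π.parts := by
        rw [add_comm, Multiset.filter_add_not]
      have hx' : x ∈ π.parts.filter (k < ·) := Multiset.mem_filter.2 ⟨hx, hkx⟩
      refine ⟨⟨⟨((π.parts.filter (¬ k < ·)).sum, (π.parts.filter (k < ·)).sum), ?_⟩,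
        ⟨filterParts π (¬ k < ·), ?_⟩, ⟨filterParts π (k < ·), ?_⟩⟩, ?_⟩
      · rw [mem_filter, HasAntidiagonal.mem_antidiagonal, ← Multiset.sum_add, hsplit]
        have := Multiset.le_sum_of_mem hx'
        exact ⟨π.parts_sum, by dsimp only; omega⟩
      · intro p hp
        obtain ⟨hp, hpk⟩ := Multiset.mem_filter.1 hp
        have : p ≠ k := fun h => hmem (h ▸ hp)
        omega
      · rw [gapFree_and_smallestPart_eq_succ_iff]
        refine ⟨⟨x, hx'⟩, fun y hy => (Multiset.mem_filter.1 hy).2, fun y hy j hkj hjy => ?_⟩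
        exact Multiset.mem_filter.2 ⟨hgap y (Multiset.mem_of_mem_filter hy) j hkj hjy, hkj⟩
      · exact Subtype.ext (Nat.Partition.ext hsplit)
  rw [g, ← Nat.card_eq_of_bijective merge hbij, Nat.card_sigma]
  simp only [Nat.card_prod]
  exact Finset.sum_coe_sort _ fun ab : ℕ × ℕ => pLe (k - 1) ab.1 * Ggap (k + 1) ab.2
end
end

section
/- The sequence σL(n) − σmaex(n) is weakly increasing in n: for every integer n ≥ 1, σL(n+1) − σmaex(n+1) ≥ σL(n) − σmaex(n). -/
open Finset

noncomputable section

/-- `σmaex n`, the sum of maximal excludants over all partitions of `n`. -/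
def sigmaMaex (n : ℕ) : ℕ := ∑ π : n.Partition, maex π

/-- `σL n`, the sum of largest parts over all partitions of `n`. -/
def sigmaL (n : ℕ) : ℕ := ∑ π : n.Partition, largestPart π

/-- Adjoining a part equal to `1` to a partition. -/
def consOne {n : ℕ} (π : n.Partition) : (n + 1).Partition where
  parts := 1 ::ₘ π.parts
  parts_pos := by
    intro i hi
    rcases Multiset.mem_cons.1 hi with rfl | h
    · exact Nat.one_pos
    · exact π.parts_pos h
  parts_sum := by rw [Multiset.sum_cons, π.parts_sum, add_comm]

theorem consOne_injective (n : ℕ) :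
    Function.Injective (consOne : n.Partition → (n + 1).Partition) := by
  intro π ρ h
  exact Nat.Partition.ext ((Multiset.cons_inj_right 1).1 (congrArg Nat.Partition.parts h))

theorem one_le_largestPart {n : ℕ} (hn : 1 ≤ n) (π : n.Partition) : 1 ≤ largestPart π := by
  obtain ⟨a, ha⟩ := Multiset.exists_mem_of_ne_zero (s := π.parts) (by
    intro h
    have hs := π.parts_sum
    rw [h, Multiset.sum_zero] at hs
    omega)
  exact (Nat.succ_le_of_lt (π.parts_pos ha)).trans (Multiset.le_sup ha)

theorem largestPart_consOne {n : ℕ} (hn : 1 ≤ n) (π : n.Partition) :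
    largestPart (consOne π) = largestPart π := by
  have h : largestPart (consOne π) = 1 ⊔ largestPart π := Multiset.sup_cons _ _
  rw [h, sup_eq_right.2 (one_le_largestPart hn π)]

theorem maex_consOne_le {n : ℕ} (hn : 1 ≤ n) (π : n.Partition) :
    maex (consOne π) ≤ maex π := by
  unfold maex
  rw [largestPart_consOne hn]
  exact Nat.findGreatest_mono_left (fun j hj h => hj (Multiset.mem_cons_of_mem h)) _

theorem maex_le_largestPart {n : ℕ} (π : n.Partition) : maex π ≤ largestPart π :=
  (Nat.findGreatest_le _).trans (Nat.sub_le _ _)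

theorem sigmaL_sub_sigmaMaex_eq_sum (n : ℕ) :
    (sigmaL n : ℤ) - (sigmaMaex n : ℤ) =
      ∑ π : n.Partition, ((largestPart π : ℤ) - (maex π : ℤ)) := by
  simp [sigmaL, sigmaMaex, Finset.sum_sub_distrib]

/-- The sequence `σL(n) − σmaex(n)` is weakly increasing: for every
`n ≥ 1`, `σL(n+1) − σmaex(n+1) ≥ σL(n) − σmaex(n)`. -/
theorem sigmaL_sub_sigmaMaex_monotone (n : ℕ) (hn : 1 ≤ n) :
    (sigmaL n : ℤ) - (sigmaMaex n : ℤ) ≤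
      (sigmaL (n + 1) : ℤ) - (sigmaMaex (n + 1) : ℤ) := by
  rw [sigmaL_sub_sigmaMaex_eq_sum, sigmaL_sub_sigmaMaex_eq_sum]
  calc ∑ π : n.Partition, ((largestPart π : ℤ) - (maex π : ℤ))
      ≤ ∑ π : n.Partition, ((largestPart (consOne π) : ℤ) - (maex (consOne π) : ℤ)) := by
        refine Finset.sum_le_sum fun π _ => ?_
        rw [largestPart_consOne hn]
        exact sub_le_sub_left (Nat.cast_le.2 (maex_consOne_le hn π)) _
    _ = ∑ ρ ∈ Finset.univ.map ⟨consOne, consOne_injective n⟩,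
          ((largestPart ρ : ℤ) - (maex ρ : ℤ)) := by
        rw [Finset.sum_map]; rfl
    _ ≤ ∑ ρ : (n + 1).Partition, ((largestPart ρ : ℤ) - (maex ρ : ℤ)) :=
        Finset.sum_le_sum_of_subset_of_nonneg (Finset.subset_univ _) fun ρ _ _ =>
          sub_nonneg.2 (Nat.cast_le.2 (maex_le_largestPart ρ))
end
end

section
/- As n → ∞, σL(n) − σmaex(n) ∼ (1/(4√3 · n)) · e^{π √(2n/3)}, i.e., the ratio (σL(n) − σmaex(n)) / ((1/(4√3 · n)) e^{π √(2n/3)}) tends to 1. -/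
open Finset

noncomputable section

open Filter Real

/-- The number of partitions of `n` all of whose parts are at most `N`. -/
def cardPartsLE (N n : ℕ) : ℕ := #(Nat.Partition.restricted n (· ≤ N))

lemma cardPartsLE_le_card (N n : ℕ) : cardPartsLE N n ≤ Fintype.card n.Partition :=
  Finset.card_le_univ _

lemma cardPartsLE_of_le {N n : ℕ} (h : n ≤ N) : cardPartsLE N n = Fintype.card n.Partition := by
  rw [cardPartsLE, Nat.Partition.restricted, Finset.filter_true_of_mem, Finset.card_univ]
  exact fun p _ i hi => (Nat.Partition.le_of_mem_parts hi).trans h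

open PowerSeries.WithPiTopology in
lemma mk_cardPartsLE_eq_prod (N : ℕ) :
    PowerSeries.mk (fun n => (cardPartsLE N n : ℤ)) =
      ∏ i ∈ range N, ∑' j : ℕ, (PowerSeries.X ^ ((i + 1) * j) : PowerSeries ℤ) := by
  have h := Nat.Partition.hasProd_powerSeriesMk_card_restricted ℤ (· ≤ N)
  have h' := hasProd_prod_of_ne_finset_one (L := .unconditional ℕ) (s := range N) (f := fun i : ℕ =>
      if i + 1 ≤ N then ∑' j : ℕ, (PowerSeries.X ^ ((i + 1) * j) : PowerSeries ℤ) else 1)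
    (fun i hi => if_neg (by simpa [Nat.succ_le_iff] using hi))
  refine (h.unique h').trans (Finset.prod_congr rfl fun i hi => ?_)
  rw [if_pos (by simpa [Nat.succ_le_iff] using hi)]

open PowerSeries.WithPiTopology in
lemma mk_cardPartsLE_succ_mul (N : ℕ) :
    PowerSeries.mk (fun n => (cardPartsLE (N + 1) n : ℤ)) * (1 - PowerSeries.X ^ (N + 1)) =
      PowerSeries.mk (fun n => (cardPartsLE N n : ℤ)) := by
  rw [mk_cardPartsLE_eq_prod, mk_cardPartsLE_eq_prod, Finset.prod_range_succ, mul_assoc]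
  simp_rw [pow_mul]
  rw [tsum_pow_mul_one_sub_of_constantCoeff_eq_zero (by simp), mul_one]

lemma cardPartsLE_zero (n : ℕ) : cardPartsLE 0 n = if n = 0 then 1 else 0 := by
  have h := congrArg (PowerSeries.coeff n) (mk_cardPartsLE_eq_prod 0)
  simp only [PowerSeries.coeff_mk, range_zero, prod_empty, PowerSeries.coeff_one] at h
  exact_mod_cast h

lemma cardPartsLE_succ (N n : ℕ) : cardPartsLE (N + 1) n =
    cardPartsLE N n + if N + 1 ≤ n then cardPartsLE (N + 1) (n - (N + 1)) else 0 := by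
  have h := congrArg (PowerSeries.coeff n) (mk_cardPartsLE_succ_mul N)
  rw [mul_sub, mul_one, map_sub, PowerSeries.coeff_mul_X_pow'] at h
  simp only [PowerSeries.coeff_mk] at h
  zify
  split_ifs at h ⊢ <;> linarith

lemma summable_cardPartsLE (N : ℕ) {r : ℝ} (h0 : 0 ≤ r) (h1 : r < 1) :
    Summable fun n => (cardPartsLE N n : ℝ) * r ^ n := by
  induction N with
  | zero =>
    refine summable_of_ne_finset_zero (s := {0}) fun n hn => ?_
    simp [cardPartsLE_zero, show n ≠ 0 by simpa using hn]
  | succ N ih =>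
    have hr : 0 < 1 - r ^ (N + 1) := by
      have : r ^ (N + 1) < 1 := pow_lt_one₀ h0 h1 (Nat.succ_ne_zero N)
      linarith
    refine summable_of_sum_range_le
      (c := (∑' n, (cardPartsLE N n : ℝ) * r ^ n) / (1 - r ^ (N + 1)))
      (fun n => by positivity) fun M => ?_
    rw [le_div_iff₀ hr]
    have hS := ih.sum_le_tsum (range M) (fun n _ => by positivity)
    have hshift : ∑ n ∈ range M,
        ((if N + 1 ≤ n then cardPartsLE (N + 1) (n - (N + 1)) else 0 : ℕ) : ℝ) * r ^ n ≤
        r ^ (N + 1) * ∑ n ∈ range M, (cardPartsLE (N + 1) n : ℝ) * r ^ n := by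
      rw [Finset.mul_sum]
      calc _ ≤ ∑ n ∈ range (N + 1 + M),
            ((if N + 1 ≤ n then cardPartsLE (N + 1) (n - (N + 1)) else 0 : ℕ) : ℝ) * r ^ n :=
            Finset.sum_le_sum_of_subset_of_nonneg (Finset.range_mono (by lia))
              fun n _ _ => by positivity
        _ = _ := by
          rw [Finset.sum_range_add, Finset.sum_eq_zero, zero_add]
          · refine Finset.sum_congr rfl fun n _ => ?_
            simp [pow_add]
            ring
          · intro n hn
            rw [if_neg (by have := Finset.mem_range.1 hn; lia)]
            simp
    have hrec : ∑ n ∈ range M, (cardPartsLE (N + 1) n : ℝ) * r ^ n =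
        ∑ n ∈ range M, (cardPartsLE N n : ℝ) * r ^ n + ∑ n ∈ range M,
        ((if N + 1 ≤ n then cardPartsLE (N + 1) (n - (N + 1)) else 0 : ℕ) : ℝ) * r ^ n := by
      rw [← Finset.sum_add_distrib]
      refine Finset.sum_congr rfl fun n _ => ?_
      conv_lhs => rw [cardPartsLE_succ]
      push_cast
      ring
    linarith

lemma hasSum_cardPartsLE (N : ℕ) {q : ℂ} (hq : ‖q‖ < 1) :
    HasSum (fun n => (cardPartsLE N n : ℂ) * q ^ n) (∏ i ∈ range N, (1 - q ^ (i + 1)))⁻¹ := by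
  induction N with
  | zero =>
    convert! hasSum_ite_eq (0 : ℕ) (1 : ℂ) using 2 with n
    · by_cases h : n = 0 <;> simp [cardPartsLE_zero, h]
    · simp
  | succ N ih =>
    have hs : Summable fun n => (cardPartsLE (N + 1) n : ℂ) * q ^ n :=
      .of_norm (by simpa using summable_cardPartsLE (N + 1) (norm_nonneg q) hq)
    obtain ⟨S, hS⟩ := hs
    have hne : 1 - q ^ (N + 1) ≠ 0 := by
      intro h
      have h' := congrArg norm (sub_eq_zero.1 h)
      rw [norm_one, norm_pow] at h'
      exact (pow_lt_one₀ (norm_nonneg q) hq (Nat.succ_ne_zero N)).ne' h'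
    have hshift : HasSum (fun n =>
        ((if N + 1 ≤ n then cardPartsLE (N + 1) (n - (N + 1)) else 0 : ℕ) : ℂ) * q ^ n)
        (q ^ (N + 1) * S) := by
      rw [← hasSum_nat_add_iff' (N + 1), Finset.sum_eq_zero, sub_zero]
      · convert! hS.mul_left (q ^ (N + 1)) using 2 with n
        simp [pow_add]
        ring
      · intro n hn
        rw [if_neg (by have := Finset.mem_range.1 hn; lia)]
        simp
    have hadd := ih.add hshift
    have hrec : (fun n => (cardPartsLE N n : ℂ) * q ^ n +
        ((if N + 1 ≤ n then cardPartsLE (N + 1) (n - (N + 1)) else 0 : ℕ) : ℂ) * q ^ n) =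
        fun n => (cardPartsLE (N + 1) n : ℂ) * q ^ n := by
      funext n
      conv_rhs => rw [cardPartsLE_succ]
      push_cast
      ring
    rw [hrec] at hadd
    have h := hadd.unique hS
    convert! hS using 1
    rw [Finset.prod_range_succ, mul_inv, ← div_eq_mul_inv, div_eq_iff hne]
    linear_combination h

lemma one_sub_pow_tprod_ne_zero {q : ℂ} (hq : ‖q‖ < 1) : ∏' i : ℕ, (1 - q ^ (i + 1)) ≠ 0 := by
  have hs : Summable fun i : ℕ => ‖q‖ ^ (i + 1) :=
    (summable_nat_add_iff 1).2 (summable_geometric_of_lt_one (norm_nonneg _) hq)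
  simp_rw [sub_eq_add_neg]
  refine tprod_one_add_ne_zero_of_summable (fun i h => ?_) (by simpa using hs)
  have h' : q ^ (i + 1) = 1 := by linear_combination -h
  have h'' := congrArg norm h'
  rw [norm_one, norm_pow] at h''
  exact (pow_lt_one₀ (norm_nonneg q) hq (Nat.succ_ne_zero i)).ne h''

lemma tendsto_prod_one_sub_pow_inv {q : ℂ} (hq : ‖q‖ < 1) :
    Tendsto (fun N => (∏ i ∈ range N, (1 - q ^ (i + 1)))⁻¹) atTop
      (nhds (∏' i : ℕ, (1 - q ^ (i + 1)))⁻¹) :=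
  (ModularForm.multipliable_one_sub_pow hq).hasProd.tendsto_prod_nat.inv₀
    (one_sub_pow_tprod_ne_zero hq)

lemma summable_card_partition {r : ℝ} (h0 : 0 ≤ r) (h1 : r < 1) :
    Summable fun n : ℕ => (Fintype.card n.Partition : ℝ) * r ^ n := by
  have hr : ‖(r : ℂ)‖ < 1 := by simpa [abs_of_nonneg h0] using h1
  obtain ⟨C, hC⟩ := (tendsto_prod_one_sub_pow_inv hr).norm.bddAbove_range
  refine summable_of_sum_range_le (c := C) (fun n => by positivity) fun M => ?_
  calc ∑ n ∈ range M, (Fintype.card n.Partition : ℝ) * r ^ n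
      = ∑ n ∈ range M, (cardPartsLE M n : ℝ) * r ^ n :=
        Finset.sum_congr rfl fun n hn => by
          rw [cardPartsLE_of_le (Finset.mem_range.1 hn).le]
    _ ≤ ∑' n, (cardPartsLE M n : ℝ) * r ^ n :=
        (summable_cardPartsLE M h0 h1).sum_le_tsum _ fun n _ => by positivity
    _ ≤ ‖((∑' n, (cardPartsLE M n : ℝ) * r ^ n : ℝ) : ℂ)‖ := by
        rw [Complex.norm_real]
        exact le_abs_self _
    _ ≤ C := by
        have h := (hasSum_cardPartsLE M hr).tsum_eq
        push_cast
        rw [h]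
        exact hC ⟨M, rfl⟩

lemma hasSum_card_partition {q : ℂ} (hq : ‖q‖ < 1) :
    HasSum (fun n : ℕ => (Fintype.card n.Partition : ℂ) * q ^ n)
      (∏' i : ℕ, (1 - q ^ (i + 1)))⁻¹ := by
  have hs := summable_card_partition (norm_nonneg q) hq
  have hlim := tendsto_tsum_of_dominated_convergence (𝓕 := atTop)
    (f := fun N n => (cardPartsLE N n : ℂ) * q ^ n)
    (g := fun n => (Fintype.card n.Partition : ℂ) * q ^ n) hs
    (fun n => tendsto_const_nhds.congr' (by
      filter_upwards [eventually_ge_atTop n] with N hN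
      rw [cardPartsLE_of_le hN]))
    (Eventually.of_forall fun N n => by
      rw [norm_mul, norm_pow, Complex.norm_natCast]
      gcongr
      exact cardPartsLE_le_card N n)
  simp_rw [(hasSum_cardPartsLE _ hq).tsum_eq] at hlim
  rw [tendsto_nhds_unique (tendsto_prod_one_sub_pow_inv hq) hlim]
  exact (Summable.of_norm (by simpa using hs)).hasSum

/-- The generating function `∏ 1 / (1 - q ^ i)` of the partition numbers on the unit disc. -/
def partitionGF (q : ℂ) : ℂ := (∏' i : ℕ, (1 - q ^ (i + 1)))⁻¹

lemma norm_partitionGF_le {q : ℂ} {r : ℝ} (hq : ‖q‖ ≤ r) (hr : r < 1) :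
    ‖partitionGF q‖ ≤ ∑' n : ℕ, (Fintype.card n.Partition : ℝ) * r ^ n := by
  have h0 : 0 ≤ r := (norm_nonneg q).trans hq
  have hs := summable_card_partition h0 hr
  rw [partitionGF, ← (hasSum_card_partition (hq.trans_lt hr)).tsum_eq]
  refine tsum_of_norm_bounded hs.hasSum fun n => ?_
  rw [norm_mul, norm_pow, Complex.norm_natCast]
  gcongr

lemma continuousAt_partitionGF {q : ℂ} (hq : ‖q‖ < 1) : ContinuousAt partitionGF q := by
  refine ContinuousAt.inv₀ ?_ (one_sub_pow_tprod_ne_zero hq)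
  exact (ModularForm.differentiableOn_tprod_one_sub_pow.differentiableAt
    (Metric.isOpen_ball.mem_nhds (by simpa using hq))).continuousAt

lemma partitionGF_zero : partitionGF 0 = 1 := by
  simp [partitionGF]

lemma sqrt_I_mul {w : ℂ} (hw : 0 < w.re) :
    Complex.sqrt (Complex.I * w) = Complex.sqrt Complex.I * Complex.sqrt w := by
  have hw0 : w ≠ 0 := by
    rintro rfl
    simp at hw
  have h := abs_lt.1 (Complex.abs_arg_lt_pi_div_two_iff.2 (Or.inl hw))
  rw [_root_.sqrt_eq_exp (mul_ne_zero Complex.I_ne_zero hw0), _root_.sqrt_eq_exp hw0,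
    _root_.sqrt_eq_exp Complex.I_ne_zero,
    Complex.log_mul Complex.I_ne_zero hw0, ← Complex.exp_add]
  · ring_nf
  · rw [Complex.arg_I]
    constructor <;> linarith [Real.pi_pos]

/-- The functional equation of the partition generating function, i.e. of the Dedekind eta
function. -/
lemma partitionGF_exp_neg {s : ℂ} (hs : 0 < s.re) :
    partitionGF (Complex.exp (-s)) = Complex.sqrt (s / (2 * π)) *
      Complex.exp (π ^ 2 / (6 * s) - s / 24) * partitionGF (Complex.exp (-(4 * π ^ 2 / s))) := by
  have hs0 : s ≠ 0 := by
    rintro rfl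
    simp at hs
  have hpi : (π : ℂ) ≠ 0 := by exact_mod_cast Real.pi_ne_zero
  set w : ℂ := s / (2 * π) with hw
  have hwre : 0 < w.re := by
    have : w = ((2 * π)⁻¹ : ℝ) * s := by rw [hw]; push_cast; field_simp
    rw [this, Complex.re_ofReal_mul]
    positivity
  have hI : (Complex.I * w) ∈ UpperHalfPlane.upperHalfPlaneSet := by
    simpa [UpperHalfPlane.upperHalfPlaneSet] using hwre
  have h := ModularForm.eta_comp_eq_csqrt_I_inv hI
  have e1 : 2 * π * Complex.I * (Complex.I * w) = -s := by
    rw [hw]; field_simp; linear_combination Complex.I_sq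
  have e2 : 2 * π * Complex.I * (-1 / (Complex.I * w)) = -(4 * π ^ 2 / s) := by
    rw [hw]; field_simp; ring
  have hI0 : Complex.sqrt Complex.I ≠ 0 := by
    rw [_root_.sqrt_eq_exp Complex.I_ne_zero]; exact Complex.exp_ne_zero _
  simp only [Function.comp, Pi.smul_apply, Pi.mul_apply, smul_eq_mul, ModularForm.eta,
    ModularForm.eta_q_eq_pow, e1, e2, Function.Periodic.qParam] at h
  rw [sqrt_I_mul hwre] at h
  have hn : ‖Complex.exp (-s)‖ < 1 := by simpa [Complex.norm_exp] using hs
  have hn' : ‖Complex.exp (-(4 * π ^ 2 / s))‖ < 1 := by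
    have : (4 * π ^ 2 / s : ℂ) = ((4 * π ^ 2 : ℝ) : ℂ) * s⁻¹ := by push_cast; ring
    rw [this, Complex.norm_exp, Complex.neg_re, Complex.re_ofReal_mul, Complex.inv_re]
    have := Complex.normSq_pos.2 hs0
    simp only [Real.exp_lt_one_iff, Left.neg_neg_iff]
    positivity
  have h1 := one_sub_pow_tprod_ne_zero hn
  have h2 := one_sub_pow_tprod_ne_zero hn'
  rw [partitionGF, partitionGF]
  have e3 : Complex.exp (π ^ 2 / (6 * s) - s / 24) *
      Complex.exp (-(4 * π ^ 2 / s) / (24 : ℝ)) = Complex.exp (-s / (24 : ℝ)) := by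
    rw [← Complex.exp_add]
    congr 1
    push_cast
    field_simp
    ring
  rw [← e3, mul_assoc Complex.I.sqrt, inv_mul_cancel_left₀ hI0] at h
  have h' : ∏' i : ℕ, (1 - Complex.exp (-(4 * π ^ 2 / s)) ^ (i + 1)) = Complex.sqrt w *
      Complex.exp (π ^ 2 / (6 * s) - s / 24) * ∏' i : ℕ, (1 - Complex.exp (-s) ^ (i + 1)) := by
    refine mul_left_cancel₀ (Complex.exp_ne_zero (-(4 * π ^ 2 / s) / (24 : ℝ))) ?_
    rw [h]
    ring
  rw [eq_mul_inv_iff_mul_eq₀ h2, h', mul_comm _⁻¹, mul_inv_cancel_right₀ h1]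

lemma one_sub_mul_exp_le_norm {z : ℂ} (hz : ‖z‖ < 1) :
    (1 - ‖z‖) * Real.exp ((‖z‖ - z.re) / 5) ≤ ‖1 - z‖ := by
  set r := ‖z‖ with hr
  have hr0 : 0 ≤ r := norm_nonneg z
  have hx : |z.re| ≤ r := Complex.abs_re_le_norm z
  have hx' := abs_le.1 hx
  have hsq : ‖1 - z‖ ^ 2 = (1 - r) ^ 2 + 2 * (r - z.re) := by
    rw [← Complex.normSq_eq_norm_sq, hr]
    have : ‖z‖ ^ 2 = z.re * z.re + z.im * z.im := by
      rw [← Complex.normSq_eq_norm_sq, Complex.normSq_apply]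
    simp only [Complex.normSq_apply, Complex.sub_re, Complex.one_re, Complex.sub_im,
      Complex.one_im]
    linear_combination -this
  refine le_of_sq_le_sq ?_ (norm_nonneg _)
  rw [hsq, mul_pow, ← Real.exp_nat_mul]
  set y := 2 * (r - z.re) with hy
  have hy0 : 0 ≤ y := by linarith
  have hy4 : y < 4 := by linarith
  have hexp : Real.exp (y / 5) ≤ 1 + y := by
    have h1 : 1 - y / 5 ≤ Real.exp (-(y / 5)) := by linarith [Real.add_one_le_exp (-(y / 5))]
    rw [Real.exp_neg] at h1
    have h2 : 0 < 1 - y / 5 := by linarith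
    calc Real.exp (y / 5) ≤ (1 - y / 5)⁻¹ := (le_inv_comm₀ h2 (Real.exp_pos _)).1 h1
      _ ≤ 1 + y := by
        rw [inv_le_iff_one_le_mul₀ h2]
        nlinarith
  have e : ((2 : ℕ) : ℝ) * ((r - z.re) / 5) = y / 5 := by push_cast; rw [hy]; ring
  rw [e]
  have h3 : (1 - r) ^ 2 ≤ 1 := by nlinarith
  nlinarith [mul_le_mul_of_nonneg_left hexp (sq_nonneg (1 - r))]

lemma norm_partitionGF_le_mul_exp {z : ℂ} (hz : ‖z‖ < 1) :
    ‖partitionGF z‖ ≤ ‖partitionGF (‖z‖ : ℂ)‖ *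
      Real.exp (-((‖z‖ / (1 - ‖z‖) - ‖z‖ / ‖1 - z‖) / 5)) := by
  set r := ‖z‖ with hr
  have hr0 : 0 ≤ r := norm_nonneg z
  have hrn : ‖(r : ℂ)‖ < 1 := by simpa [abs_of_nonneg hr0] using hz
  have hone : 1 - z ≠ 0 := by
    intro h
    rw [hr, ← sub_eq_zero.1 h] at hz
    simp at hz
  have hpos : 0 < ‖1 - z‖ := norm_pos_iff.2 hone
  have hgeo : ∀ {q : ℂ}, ‖q‖ < 1 → HasSum (fun i : ℕ => q ^ (i + 1)) (q / (1 - q)) := by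
    intro q hq
    simpa [pow_succ, div_eq_mul_inv, mul_comm] using (hasSum_geometric_of_norm_lt_one hq).mul_left q
  have hgeor : HasSum (fun i : ℕ => r ^ (i + 1)) (r / (1 - r)) := by
    simpa [pow_succ, div_eq_mul_inv, mul_comm] using (hasSum_geometric_of_lt_one hr0 hz).mul_left r
  have hD := (hgeor.sub (Complex.hasSum_re (hgeo hz))).tendsto_sum_nat
  have hprod : ∀ {q : ℂ}, ‖q‖ < 1 → Tendsto (fun N => ∏ i ∈ range N, ‖1 - q ^ (i + 1)‖) atTop
      (nhds ‖∏' i : ℕ, (1 - q ^ (i + 1))‖) := by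
    intro q hq
    simpa only [norm_prod] using
      (ModularForm.multipliable_one_sub_pow hq).hasProd.tendsto_prod_nat.norm
  have hexp := (Real.continuous_exp.tendsto _).comp (hD.div_const 5)
  have hkey := le_of_tendsto_of_tendsto' ((hprod hrn).mul hexp) (hprod hz) fun N => by
    simp only [Function.comp]
    rw [Finset.sum_div, Real.exp_sum, ← Finset.prod_mul_distrib]
    refine Finset.prod_le_prod (fun i _ => by positivity) fun i _ => ?_
    have hlt : ‖z ^ (i + 1)‖ < 1 := by
      rw [norm_pow]
      exact pow_lt_one₀ hr0 hz (Nat.succ_ne_zero i)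
    have h := one_sub_mul_exp_le_norm hlt
    rw [norm_pow, ← hr] at h
    convert! h using 2
    have : (1 : ℂ) - (r : ℂ) ^ (i + 1) = ((1 - r ^ (i + 1) : ℝ) : ℂ) := by push_cast; rfl
    rw [this, Complex.norm_real, Real.norm_eq_abs, abs_of_nonneg]
    rw [norm_pow] at hlt
    linarith
  have hre : (z / (1 - z)).re ≤ r / ‖1 - z‖ := by
    rw [hr, ← norm_div]
    exact Complex.re_le_norm _
  rw [partitionGF, partitionGF, norm_inv, norm_inv, Real.exp_neg, ← mul_inv]
  have hp := norm_pos_iff.2 (one_sub_pow_tprod_ne_zero hrn)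
  refine inv_anti₀ (by positivity) (le_trans ?_ hkey)
  gcongr

lemma norm_partitionGF_le_of_abs_ge {t θ : ℝ} (ht : 0 < t) (ht' : t ≤ 1 / 2) (h1 : t ≤ |θ|)
    (h2 : |θ| ≤ π) : ‖partitionGF (Complex.exp (-(t + θ * Complex.I)))‖ ≤
      ‖partitionGF (Complex.exp (-t))‖ * Real.exp (-(1 / 250 / t)) := by
  set z := Complex.exp (-(t + θ * Complex.I)) with hz
  have hnorm : ‖z‖ = Real.exp (-t) := by simp [hz, Complex.norm_exp]
  have hre : z.re = Real.exp (-t) * Real.cos θ := by simp [hz, Complex.exp_re]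
  set r := Real.exp (-t) with hr
  have hr1 : r < 1 := by simpa [hr] using ht
  have hrt : 1 - r ≤ t := by linarith [Real.add_one_le_exp (-t)]
  have hr2 : 1 / 2 ≤ r := by linarith
  have hsq : ‖1 - z‖ ^ 2 = (1 - r) ^ 2 + 2 * r * (1 - Real.cos θ) := by
    rw [← Complex.normSq_eq_norm_sq]
    have : r ^ 2 = z.re * z.re + z.im * z.im := by
      rw [← hnorm, ← Complex.normSq_eq_norm_sq, Complex.normSq_apply]
    simp only [Complex.normSq_apply, Complex.sub_re, Complex.one_re, Complex.sub_im,
      Complex.one_im]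
    linear_combination -this - 2 * hre
  have hcos : 1 / 5 * (1 - r) ^ 2 ≤ 1 - Real.cos θ := by
    have hc := Real.cos_le_one_sub_mul_cos_sq h2
    have hpi : 1 / 5 ≤ 2 / π ^ 2 := by
      rw [div_le_div_iff₀ (by norm_num) (by positivity)]
      nlinarith [Real.pi_lt_d2, Real.pi_pos]
    have hθ : (1 - r) ^ 2 ≤ θ ^ 2 := by
      rw [← sq_abs θ]
      exact pow_le_pow_left₀ (by linarith) (hrt.trans h1) 2
    have := mul_le_mul hpi hθ (sq_nonneg _) (by positivity)
    linarith
  have hlow : 21 / 20 * (1 - r) ≤ ‖1 - z‖ := by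
    refine le_of_sq_le_sq ?_ (norm_nonneg _)
    rw [hsq]
    nlinarith [sq_nonneg (1 - r)]
  have h := norm_partitionGF_le_mul_exp (z := z) (by rw [hnorm]; exact hr1)
  rw [hnorm] at h
  have e : ((r : ℝ) : ℂ) = Complex.exp (-t) := by rw [hr]; push_cast; rfl
  rw [e] at h
  refine h.trans ?_
  refine mul_le_mul_of_nonneg_left (Real.exp_le_exp.2 ?_) (norm_nonneg _)
  have hr1' : 0 < 1 - r := by linarith
  have h3 : r / ‖1 - z‖ ≤ 20 / 21 * (r / (1 - r)) := by
    calc r / ‖1 - z‖ ≤ r / (21 / 20 * (1 - r)) := by gcongr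
      _ = 20 / 21 * (r / (1 - r)) := by field_simp
  have h4 : 1 / 2 / t ≤ r / (1 - r) := by gcongr
  have h5 : 1 / 250 / t = 1 / 125 * (1 / 2 / t) := by ring
  have h6 : 0 < 1 / 2 / t := by positivity
  linarith

lemma integral_exp_int_mul_I (k : ℤ) :
    ∫ θ in (-π)..π, Complex.exp (k * θ * Complex.I) = if k = 0 then (2 * π : ℂ) else 0 := by
  split_ifs with hk
  · simp [hk, two_mul]
  · have hc : (k * Complex.I : ℂ) ≠ 0 :=
      mul_ne_zero (by exact_mod_cast hk) Complex.I_ne_zero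
    have h := integral_exp_mul_complex (a := -π) (b := π) hc
    simp_rw [show ∀ θ : ℝ, (k * θ * Complex.I : ℂ) = k * Complex.I * θ from fun θ => by ring]
    rw [h, div_eq_zero_iff]
    left
    rw [sub_eq_zero, Complex.exp_eq_exp_iff_exists_int]
    refine ⟨k, ?_⟩
    push_cast
    ring

lemma card_partition_mul_exp_eq_integral (n : ℕ) {t : ℝ} (ht : 0 < t) :
    (Fintype.card n.Partition : ℂ) * Complex.exp (-(n * t)) * (2 * π) =
      ∫ θ in (-π)..π, partitionGF (Complex.exp (-(t + θ * Complex.I))) *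
        Complex.exp (n * θ * Complex.I) := by
  have hr1 : Real.exp (-t) < 1 := by simpa using ht
  have hs := summable_card_partition (Real.exp_pos _).le hr1
  have hnorm : ∀ θ : ℝ, ‖Complex.exp (-(t + θ * Complex.I))‖ = Real.exp (-t) := fun θ => by
    simp [Complex.norm_exp]
  have h := intervalIntegral.hasSum_integral_of_dominated_convergence
    (μ := MeasureTheory.volume) (a := -π) (b := π)
    (F := fun (m : ℕ) (θ : ℝ) => (Fintype.card m.Partition : ℂ) *
      Complex.exp (-(t + θ * Complex.I)) ^ m * Complex.exp (n * θ * Complex.I))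
    (f := fun θ : ℝ => partitionGF (Complex.exp (-(t + θ * Complex.I))) *
        Complex.exp (n * θ * Complex.I))
    (fun m _ => (Fintype.card m.Partition : ℝ) * Real.exp (-t) ^ m)
    (fun m => by
      refine Continuous.aestronglyMeasurable ?_
      fun_prop)
    (fun m => Eventually.of_forall fun θ _ => by
      rw [norm_mul, norm_mul, norm_pow, hnorm, Complex.norm_natCast]
      have : ‖Complex.exp (n * θ * Complex.I)‖ = 1 := by simp [Complex.norm_exp]
      rw [this, mul_one])
    (Eventually.of_forall fun θ _ => hs)
    (by simp)
    (Eventually.of_forall fun θ _ =>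
      (hasSum_card_partition (by rw [hnorm]; exact hr1)).mul_right _)
  have hint : ∀ m : ℕ, ∫ θ in (-π)..π, (Fintype.card m.Partition : ℂ) *
      Complex.exp (-(t + θ * Complex.I)) ^ m * Complex.exp (n * θ * Complex.I) =
      if m = n then (Fintype.card n.Partition : ℂ) * Complex.exp (-(n * t)) * (2 * π) else 0 := by
    intro m
    have e : ∀ θ : ℝ, (Fintype.card m.Partition : ℂ) *
      Complex.exp (-(t + θ * Complex.I)) ^ m * Complex.exp (n * θ * Complex.I) =
      (Fintype.card m.Partition : ℂ) * Complex.exp (-(m * t)) *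
        Complex.exp (((n - m : ℤ) : ℂ) * θ * Complex.I) := by
      intro θ
      rw [← Complex.exp_nat_mul, mul_assoc, mul_assoc (Fintype.card m.Partition : ℂ),
        ← Complex.exp_add, ← Complex.exp_add]
      congr 2
      push_cast
      ring
    simp_rw [e]
    rw [intervalIntegral.integral_const_mul, integral_exp_int_mul_I]
    by_cases hmn : m = n
    · subst hmn; simp
    · have : (n - m : ℤ) ≠ 0 := by lia
      simp [hmn, this]
  simp_rw [hint] at h
  exact (hasSum_ite_eq n _).unique h

/-- The integrand of Cauchy's formula for the partition numbers on the circle of radius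
`exp (-π ^ 2 / (6 * x ^ 2))`, rescaled around the saddle point. -/
def saddleIntegrand (x v : ℝ) : ℂ :=
  Complex.exp (-x ^ 2) * partitionGF (Complex.exp (-(π ^ 2 / (6 * x ^ 2) * (1 + v / x * Complex.I))))
    * Complex.exp (x * v * Complex.I)

lemma one_add_mul_I_re_pos (u : ℝ) : 0 < (1 + (u : ℂ) * Complex.I).re := by simp

lemma one_add_mul_I_ne_zero (u : ℝ) : 1 + (u : ℂ) * Complex.I ≠ 0 := fun h => by
  simpa [h] using one_add_mul_I_re_pos u

lemma inv_one_add_mul_I_re (u : ℝ) : (1 + (u : ℂ) * Complex.I)⁻¹.re = 1 / (1 + u ^ 2) := by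
  simp [Complex.inv_re, Complex.normSq_apply]
  ring

lemma sqrt_ofReal_mul {r : ℝ} (hr : 0 < r) {w : ℂ} (hw : w ≠ 0) :
    Complex.sqrt (r * w) = Real.sqrt r * Complex.sqrt w := by
  have hr0 : (r : ℂ) ≠ 0 := by exact_mod_cast hr.ne'
  rw [_root_.sqrt_eq_exp (mul_ne_zero hr0 hw), _root_.sqrt_eq_exp hw,
    Complex.log_ofReal_mul hr hw, add_div, Complex.exp_add]
  congr 1
  rw [Real.sqrt_eq_rpow, Real.rpow_def_of_pos hr]
  push_cast
  congr 1
  ring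

lemma mul_saddleIntegrand_eq {x : ℝ} (hx : 0 < x) (v : ℝ) :
    x * saddleIntegrand x v = Real.sqrt (π / 12) * Complex.sqrt (1 + (v / x : ℝ) * Complex.I) *
      Complex.exp (-(v ^ 2 * (1 + (v / x : ℝ) * Complex.I)⁻¹)) *
      Complex.exp (-(π ^ 2 / (144 * x ^ 2) * (1 + (v / x : ℝ) * Complex.I))) *
      partitionGF (Complex.exp (-(24 * x ^ 2 * (1 + (v / x : ℝ) * Complex.I)⁻¹))) := by
  have hx0 : (x : ℂ) ≠ 0 := by exact_mod_cast hx.ne'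
  have hpi : (π : ℂ) ≠ 0 := by exact_mod_cast Real.pi_ne_zero
  set w : ℂ := 1 + (v / x : ℝ) * Complex.I with hw
  have hw0 : w ≠ 0 := one_add_mul_I_ne_zero _
  have hs : 0 < ((π ^ 2 / (6 * x ^ 2) : ℂ) * w).re := by
    have : (π ^ 2 / (6 * x ^ 2) : ℂ) = ((π ^ 2 / (6 * x ^ 2) : ℝ) : ℂ) := by push_cast; rfl
    rw [this, Complex.re_ofReal_mul]
    exact mul_pos (by positivity) (one_add_mul_I_re_pos _)
  have e0 : (1 + v / x * Complex.I : ℂ) = w := by rw [hw]; push_cast; rfl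
  rw [saddleIntegrand, e0, partitionGF_exp_neg hs]
  have e1 : (π ^ 2 / (6 * x ^ 2) * w / (2 * π) : ℂ) = ((π / 12 / x ^ 2 : ℝ) : ℂ) * w := by
    push_cast; field_simp; ring
  have e2 : Real.sqrt (π / 12 / x ^ 2) = Real.sqrt (π / 12) / x := by
    rw [Real.sqrt_div' _ (sq_nonneg x), Real.sqrt_sq hx.le]
  have e3 : (4 * π ^ 2 / (π ^ 2 / (6 * x ^ 2) * w) : ℂ) = 24 * x ^ 2 * w⁻¹ := by
    field_simp; ring
  rw [e1, sqrt_ofReal_mul (by positivity) hw0, e2, e3]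
  have e4 : Complex.exp (-x ^ 2) * Complex.exp (π ^ 2 / (6 * (π ^ 2 / (6 * x ^ 2) * w)) -
      π ^ 2 / (6 * x ^ 2) * w / 24) * Complex.exp (x * v * Complex.I) =
      Complex.exp (-(v ^ 2 * w⁻¹)) * Complex.exp (-(π ^ 2 / (144 * x ^ 2) * w)) := by
    rw [← Complex.exp_add, ← Complex.exp_add, ← Complex.exp_add]
    congr 1
    have hv : (v : ℂ) * Complex.I = x * (w - 1) := by
      rw [← e0]; field_simp; ring
    have hv2 : (v : ℂ) ^ 2 = -(x * (w - 1)) ^ 2 := by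
      rw [← hv, mul_pow, Complex.I_sq]; ring
    rw [mul_assoc (x : ℂ), hv, hv2]
    field_simp
    ring
  rw [mul_assoc _ (Complex.exp (-(v ^ 2 * w⁻¹))), ← e4]
  push_cast
  field_simp

lemma norm_exp_neg_mul_inv (r u : ℝ) :
    ‖Complex.exp (-(r * (1 + (u : ℂ) * Complex.I)⁻¹))‖ = Real.exp (-(r / (1 + u ^ 2))) := by
  rw [Complex.norm_exp, Complex.neg_re, Complex.re_ofReal_mul, inv_one_add_mul_I_re,
    mul_one_div]

lemma tendsto_mul_saddleIntegrand (v : ℝ) :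
    Tendsto (fun x : ℝ => x * saddleIntegrand x v) atTop
      (nhds ((Real.sqrt (π / 12) * Real.exp (-1 * v ^ 2) : ℝ) : ℂ)) := by
  have hu : Tendsto (fun x : ℝ => v / x) atTop (nhds 0) := tendsto_const_nhds.div_atTop tendsto_id
  have hw : Tendsto (fun x : ℝ => 1 + ((v / x : ℝ) : ℂ) * Complex.I) atTop (nhds 1) := by
    have := (((Complex.continuous_ofReal.tendsto 0).comp hu).mul_const Complex.I).const_add 1
    simpa using this
  have hsqrt : Tendsto (fun x : ℝ => Complex.sqrt (1 + ((v / x : ℝ) : ℂ) * Complex.I)) atTop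
      (nhds 1) := by
    have h1 : ContinuousAt Complex.sqrt 1 :=
      continuousAt_id.cpow continuousAt_const (by simp)
    have h2 := h1.tendsto
    rw [Complex.sqrt_one] at h2
    exact h2.comp hw
  have hexp : Tendsto (fun x : ℝ =>
      Complex.exp (-(v ^ 2 * (1 + ((v / x : ℝ) : ℂ) * Complex.I)⁻¹))) atTop
      (nhds (Complex.exp (-(v ^ 2 * 1⁻¹)))) :=
    (Complex.continuous_exp.tendsto _).comp ((hw.inv₀ one_ne_zero).const_mul _).neg
  have hsmall : Tendsto (fun x : ℝ => Complex.exp (-(π ^ 2 / (144 * x ^ 2) *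
      (1 + ((v / x : ℝ) : ℂ) * Complex.I)))) atTop (nhds (Complex.exp (-(0 * 1)))) := by
    refine (Complex.continuous_exp.tendsto _).comp (Tendsto.neg (Tendsto.mul ?_ hw))
    have h : Tendsto (fun x : ℝ => π ^ 2 / (144 * x ^ 2)) atTop (nhds 0) :=
      tendsto_const_nhds.div_atTop
        ((tendsto_pow_atTop two_ne_zero).const_mul_atTop (by norm_num))
    have := (Complex.continuous_ofReal.tendsto 0).comp h
    simpa [Function.comp_def] using this
  have hgf : Tendsto (fun x : ℝ => partitionGF (Complex.exp (-(24 * x ^ 2 *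
      (1 + ((v / x : ℝ) : ℂ) * Complex.I)⁻¹)))) atTop (nhds 1) := by
    have hc := continuousAt_partitionGF (q := 0) (by simp)
    rw [ContinuousAt, partitionGF_zero] at hc
    refine hc.comp (squeeze_zero_norm' ?_ (Real.tendsto_exp_atBot.comp tendsto_neg_atTop_atBot))
    filter_upwards [eventually_ge_atTop 1, eventually_ge_atTop |v|] with x hx1 hxv
    have h := norm_exp_neg_mul_inv (24 * x ^ 2) (v / x)
    push_cast at h ⊢
    rw [h]
    simp only [Function.comp]
    refine Real.exp_le_exp.2 (neg_le_neg ?_)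
    have hu2 : (v / x) ^ 2 ≤ 1 := by
      rw [← sq_abs, abs_div, abs_of_pos (by linarith : 0 < x)]
      exact pow_le_one₀ (by positivity) (div_le_one_of_le₀ hxv (by linarith))
    rw [le_div_iff₀ (by positivity)]
    nlinarith
  have h := ((((tendsto_const_nhds (x := (Real.sqrt (π / 12) : ℂ))).mul hsqrt).mul hexp).mul
    hsmall).mul hgf
  have e : (Real.sqrt (π / 12) : ℂ) * 1 * Complex.exp (-(v ^ 2 * 1⁻¹)) *
      Complex.exp (-(0 * 1)) * 1 = ((Real.sqrt (π / 12) * Real.exp (-1 * v ^ 2) : ℝ) : ℂ) := by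
    push_cast
    simp
  rw [e] at h
  refine h.congr' ?_
  filter_upwards [eventually_gt_atTop 0] with x hx
  rw [mul_saddleIntegrand_eq hx]

lemma exists_norm_mul_saddleIntegrand_le :
    ∃ C : ℝ, 0 ≤ C ∧ ∀ x v : ℝ, 1 ≤ x → |v| ≤ x →
      ‖x * saddleIntegrand x v‖ ≤ C * Real.exp (-(1 / 2) * v ^ 2) := by
  set K := ∑' n : ℕ, (Fintype.card n.Partition : ℝ) * (1 / 2) ^ n
  have hK : 0 ≤ K := tsum_nonneg fun n => by positivity
  refine ⟨Real.sqrt (π / 12) * 2 * K, by positivity, fun x v hx hv => ?_⟩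
  have hx0 : 0 < x := by linarith
  have hu1 : |v / x| ≤ 1 := by
    rw [abs_div, abs_of_pos hx0]
    exact div_le_one_of_le₀ hv hx0.le
  have hu2 : (v / x) ^ 2 ≤ 1 := by
    rw [← sq_abs]
    exact pow_le_one₀ (abs_nonneg _) hu1
  rw [mul_saddleIntegrand_eq hx0, norm_mul, norm_mul, norm_mul, norm_mul, Complex.norm_real,
    Real.norm_of_nonneg (Real.sqrt_nonneg _)]
  have h1 : ‖Complex.sqrt (1 + (v / x : ℝ) * Complex.I)‖ ≤ 2 := by
    have hn : ‖1 + ((v / x : ℝ) : ℂ) * Complex.I‖ ≤ 2 := by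
      refine (norm_add_le _ _).trans ?_
      rw [norm_mul, Complex.norm_I, Complex.norm_real, norm_one, Real.norm_eq_abs]
      linarith
    rw [_root_.sqrt_eq_exp (one_add_mul_I_ne_zero _), Complex.norm_exp]
    have : (Complex.log (1 + ((v / x : ℝ) : ℂ) * Complex.I) / 2).re ≤ Real.log 2 := by
      rw [Complex.div_ofNat_re, Complex.log_re]
      have := Real.log_le_log (norm_pos_iff.2 (one_add_mul_I_ne_zero (v / x))) hn
      have := Real.log_pos one_lt_two
      linarith
    calc _ ≤ Real.exp (Real.log 2) := Real.exp_le_exp.2 this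
      _ = 2 := Real.exp_log two_pos
  have h2 : ‖Complex.exp (-(v ^ 2 * (1 + (v / x : ℝ) * Complex.I)⁻¹))‖ ≤
      Real.exp (-(1 / 2) * v ^ 2) := by
    have h := norm_exp_neg_mul_inv (v ^ 2) (v / x)
    push_cast at h ⊢
    rw [h]
    refine Real.exp_le_exp.2 ?_
    rw [neg_mul, neg_le_neg_iff, le_div_iff₀ (by positivity)]
    nlinarith [sq_nonneg v]
  have h3 : ‖Complex.exp (-(π ^ 2 / (144 * x ^ 2) * (1 + (v / x : ℝ) * Complex.I)))‖ ≤ 1 := by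
    have : (π ^ 2 / (144 * x ^ 2) : ℂ) = ((π ^ 2 / (144 * x ^ 2) : ℝ) : ℂ) := by push_cast; rfl
    rw [this, Complex.norm_exp, Complex.neg_re, Complex.re_ofReal_mul]
    have : (1 + ((v / x : ℝ) : ℂ) * Complex.I).re = 1 := by simp
    rw [this, Real.exp_le_one_iff]
    simp only [mul_one, Left.neg_nonpos_iff]
    positivity
  have h4 : ‖partitionGF (Complex.exp (-(24 * x ^ 2 * (1 + (v / x : ℝ) * Complex.I)⁻¹)))‖ ≤ K := by
    refine norm_partitionGF_le ?_ (by norm_num)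
    have h := norm_exp_neg_mul_inv (24 * x ^ 2) (v / x)
    push_cast at h ⊢
    rw [h, Real.exp_neg]
    have h5 : 1 ≤ 24 * x ^ 2 / (1 + (v / x) ^ 2) := by
      rw [le_div_iff₀ (by positivity)]
      nlinarith
    have h6 := Real.add_one_le_exp (24 * x ^ 2 / (1 + (v / x) ^ 2))
    rw [one_div]
    exact inv_anti₀ two_pos (by linarith)
  calc _ ≤ Real.sqrt (π / 12) * 2 * Real.exp (-(1 / 2) * v ^ 2) * 1 * K := by gcongr
    _ = _ := by ring

lemma exists_norm_mul_saddleIntegrand_le' :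
    ∃ C : ℝ, ∀ x v : ℝ, 2 ≤ x → |v| ≤ 6 * x ^ 3 / π →
      ‖x * saddleIntegrand x v‖ ≤ C * (Real.exp (-(1 / 2) * v ^ 2) + (1 + v ^ 2)⁻¹) := by
  obtain ⟨C, hC0, hC⟩ := exists_norm_mul_saddleIntegrand_le
  set c : ℝ := 6 / (250 * π ^ 2) with hc
  have hcpos : 0 < c := by positivity
  set K : ℝ := 1 + 24 / c ^ 3 with hK
  have hK1 : 1 ≤ K := by rw [hK]; linarith [show 0 < 24 / c ^ 3 by positivity]
  refine ⟨C * K, fun x v hx hv => ?_⟩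
  have hx0 : 0 < x := by linarith
  rcases le_or_gt |v| x with hvx | hvx
  · calc _ ≤ C * Real.exp (-(1 / 2) * v ^ 2) := hC x v (by linarith) hvx
      _ ≤ C * K * (Real.exp (-(1 / 2) * v ^ 2) + (1 + v ^ 2)⁻¹) := by
        gcongr
        · exact le_mul_of_one_le_right hC0 hK1
        · exact le_add_of_nonneg_right (by positivity)
  · set t : ℝ := π ^ 2 / (6 * x ^ 2) with ht
    have htpos : 0 < t := by positivity
    have ht2 : t ≤ 1 / 2 := by
      rw [ht, div_le_div_iff₀ (by positivity) (by norm_num)]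
      nlinarith [Real.pi_lt_d2, Real.pi_pos]
    have habs : |t * (v / x)| = t * (|v| / x) := by
      rw [abs_mul, abs_of_pos htpos, abs_div v x, abs_of_pos hx0]
    have hge : t ≤ |t * (v / x)| := by
      rw [habs]
      exact le_mul_of_one_le_right htpos.le ((one_le_div hx0).2 hvx.le)
    have hle : |t * (v / x)| ≤ π := by
      rw [habs]
      calc t * (|v| / x) ≤ t * ((6 * x ^ 3 / π) / x) := by gcongr
        _ = π := by rw [ht]; field_simp
    have h := norm_partitionGF_le_of_abs_ge htpos ht2 hge hle
    have h0 := hC x 0 (by linarith) (by simpa using hx0.le)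
    have e1 : ((t : ℂ) + ((t * (v / x) : ℝ) : ℂ) * Complex.I) =
        π ^ 2 / (6 * x ^ 2) * (1 + v / x * Complex.I) := by
      rw [ht]; push_cast; ring
    have e2 : ((t : ℂ)) = π ^ 2 / (6 * x ^ 2) := by rw [ht]; push_cast; rfl
    rw [e1] at h
    have e3 : ‖Complex.exp (x * v * Complex.I)‖ = 1 := by
      simp [Complex.norm_exp]
    have hsad : ‖x * saddleIntegrand x v‖ ≤ C * Real.exp (-(c * x ^ 2)) := by
      rw [saddleIntegrand, norm_mul, norm_mul, norm_mul, e3, mul_one]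
      simp only [saddleIntegrand, Complex.ofReal_zero, zero_div, zero_mul, add_zero, mul_one,
        mul_zero, Complex.exp_zero, norm_mul, ← e2] at h0
      norm_num at h0
      have e4 : 1 / 250 / t = c * x ^ 2 := by rw [ht, hc]; field_simp
      rw [e4] at h
      calc _ ≤ ‖(x : ℂ)‖ * (‖Complex.exp (-x ^ 2)‖ *
            (‖partitionGF (Complex.exp (-t))‖ * Real.exp (-(c * x ^ 2)))) := by gcongr
        _ = ‖(x : ℂ)‖ * (‖Complex.exp (-x ^ 2)‖ *
            ‖partitionGF (Complex.exp (-t))‖) * Real.exp (-(c * x ^ 2)) := by ring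
        _ ≤ C * Real.exp (-(c * x ^ 2)) := by
          gcongr
          simpa using h0
    have hpoly : (1 + v ^ 2) * Real.exp (-(c * x ^ 2)) ≤ K := by
      have hv2 : v ^ 2 ≤ 4 * x ^ 6 := by
        rw [← sq_abs]
        calc |v| ^ 2 ≤ (6 * x ^ 3 / π) ^ 2 := by gcongr
          _ ≤ (6 * x ^ 3 / 3) ^ 2 := by gcongr; exact Real.pi_gt_three.le
          _ = 4 * x ^ 6 := by ring
      have hexp : (c * x ^ 2) ^ 3 / 6 ≤ Real.exp (c * x ^ 2) := by
        have := Real.pow_div_factorial_le_exp (c * x ^ 2) (by positivity) 3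
        simpa [Nat.factorial] using this
      rw [Real.exp_neg, ← div_eq_mul_inv, div_le_iff₀ (Real.exp_pos _)]
      have h1 : 1 ≤ Real.exp (c * x ^ 2) := Real.one_le_exp (by positivity)
      have h2 : 4 * x ^ 6 = 24 / c ^ 3 * ((c * x ^ 2) ^ 3 / 6) := by field_simp; ring
      have h3 := mul_le_mul_of_nonneg_left hexp (show 0 ≤ 24 / c ^ 3 by positivity)
      rw [hK]
      linarith
    calc _ ≤ C * Real.exp (-(c * x ^ 2)) := hsad
      _ ≤ C * (K * (1 + v ^ 2)⁻¹) := by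
        gcongr
        rw [← div_eq_mul_inv, le_div_iff₀ (by positivity)]
        linarith
      _ = C * K * (1 + v ^ 2)⁻¹ := by ring
      _ ≤ _ := by
        gcongr
        exact le_add_of_nonneg_left (Real.exp_pos _).le

lemma continuous_saddleIntegrand {x : ℝ} (hx : 0 < x) : Continuous (saddleIntegrand x) := by
  have h : Continuous fun v : ℝ =>
      partitionGF (Complex.exp (-(π ^ 2 / (6 * x ^ 2) * (1 + v / x * Complex.I)))) := by
    rw [continuous_iff_continuousAt]
    intro v
    refine ContinuousAt.comp (g := partitionGF) (continuousAt_partitionGF ?_)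
      (Continuous.continuousAt (by fun_prop))
    have : (π ^ 2 / (6 * x ^ 2) * (1 + v / x * Complex.I) : ℂ) =
      ((π ^ 2 / (6 * x ^ 2) : ℝ) : ℂ) * (1 + ((v / x : ℝ) : ℂ) * Complex.I) := by push_cast; rfl
    rw [this, Complex.norm_exp, Complex.neg_re, Complex.re_ofReal_mul, Real.exp_lt_one_iff,
      neg_lt_zero]
    exact mul_pos (by positivity) (one_add_mul_I_re_pos _)
  unfold saddleIntegrand
  fun_prop

lemma tendsto_integral_saddleIntegrand :
    Tendsto (fun x : ℝ => ∫ v in (-(6 * x ^ 3 / π))..(6 * x ^ 3 / π), x * saddleIntegrand x v)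
      atTop (nhds ((Real.sqrt (π / 12) * Real.sqrt π : ℝ) : ℂ)) := by
  obtain ⟨C, hC⟩ := exists_norm_mul_saddleIntegrand_le'
  have hlim : ((Real.sqrt (π / 12) * Real.sqrt π : ℝ) : ℂ) =
      ∫ v : ℝ, ((Real.sqrt (π / 12) * Real.exp (-1 * v ^ 2) : ℝ) : ℂ) := by
    rw [integral_complex_ofReal, MeasureTheory.integral_const_mul, integral_gaussian, div_one]
  rw [hlim]
  have key := MeasureTheory.tendsto_integral_filter_of_dominated_convergence
    (μ := MeasureTheory.volume) (l := atTop)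
    (F := fun (x v : ℝ) => (Set.Ioc (-(6 * x ^ 3 / π)) (6 * x ^ 3 / π)).indicator
      (fun v => x * saddleIntegrand x v) v)
    (f := fun v : ℝ => ((Real.sqrt (π / 12) * Real.exp (-1 * v ^ 2) : ℝ) : ℂ))
    (fun v => |C| * (Real.exp (-(1 / 2) * v ^ 2) + (1 + v ^ 2)⁻¹)) ?_ ?_ ?_ ?_
  · refine key.congr' ?_
    filter_upwards [eventually_gt_atTop 0] with x hx
    rw [MeasureTheory.integral_indicator measurableSet_Ioc, intervalIntegral.integral_of_le]
    have : 0 < 6 * x ^ 3 / π := by positivity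
    linarith
  · filter_upwards [eventually_gt_atTop 0] with x hx
    exact ((continuous_const.mul (continuous_saddleIntegrand hx)).aestronglyMeasurable).indicator
      measurableSet_Ioc
  · filter_upwards [eventually_ge_atTop 2] with x hx
    refine Eventually.of_forall fun v => ?_
    by_cases hv : v ∈ Set.Ioc (-(6 * x ^ 3 / π)) (6 * x ^ 3 / π)
    · rw [Set.indicator_of_mem hv]
      refine (hC x v hx (abs_le.2 ⟨hv.1.le, hv.2⟩)).trans ?_
      gcongr
      exact le_abs_self C
    · rw [Set.indicator_of_notMem hv, norm_zero]
      positivity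
  · exact ((integrable_exp_neg_mul_sq (by norm_num)).add integrable_inv_one_add_sq).const_mul _
  · refine Eventually.of_forall fun v => ?_
    refine (tendsto_mul_saddleIntegrand v).congr' ?_
    filter_upwards [eventually_ge_atTop 1, eventually_gt_atTop |v|] with x hx hv
    rw [Set.indicator_of_mem]
    have : |v| < 6 * x ^ 3 / π := by
      rw [lt_div_iff₀ Real.pi_pos]
      have h3 : x ≤ x ^ 3 := le_self_pow₀ hx (by norm_num)
      nlinarith [Real.pi_lt_four, Real.pi_pos, abs_nonneg v]
    exact ⟨(abs_lt.1 this).1, (abs_lt.1 this).2.le⟩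

lemma card_partition_eq_integral_saddleIntegrand {n : ℕ} {x : ℝ} (hx : 0 < x)
    (hn : x ^ 4 = π ^ 2 * n / 6) :
    (Fintype.card n.Partition : ℂ) * Complex.exp (-(2 * x ^ 2)) * (12 * x ^ 4 / π) =
      ∫ v in (-(6 * x ^ 3 / π))..(6 * x ^ 3 / π), x * saddleIntegrand x v := by
  have hx0 : (x : ℂ) ≠ 0 := by exact_mod_cast hx.ne'
  have hpi : (π : ℂ) ≠ 0 := by exact_mod_cast Real.pi_ne_zero
  set t : ℝ := π ^ 2 / (6 * x ^ 2) with ht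
  have htpos : 0 < t := by positivity
  have hnt : n * t = x ^ 2 := by
    have hn' : (n : ℝ) = 6 * x ^ 4 / π ^ 2 := by rw [hn]; field_simp
    rw [hn', ht]; field_simp
  have hntc : (n : ℂ) * t = x ^ 2 := by exact_mod_cast hnt
  have h := card_partition_mul_exp_eq_integral n htpos
  rw [hntc] at h
  set a : ℝ := π ^ 2 / (6 * x ^ 3) with ha
  have hapos : 0 < a := by positivity
  have hax : a * x = t := by rw [ha, ht]; field_simp
  have hsub := intervalIntegral.integral_comp_mul_left (a := -(6 * x ^ 3 / π))
    (b := 6 * x ^ 3 / π) (fun θ : ℝ => partitionGF (Complex.exp (-(t + θ * Complex.I))) *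
        Complex.exp (n * θ * Complex.I)) hapos.ne'
  have hb : a * (6 * x ^ 3 / π) = π := by rw [ha]; field_simp
  rw [mul_neg, hb, ← h] at hsub
  have hpt : ∀ v : ℝ, x * saddleIntegrand x v = x * Complex.exp (-x ^ 2) *
      (partitionGF (Complex.exp (-(t + ((a * v : ℝ) : ℂ) * Complex.I))) *
        Complex.exp (n * ((a * v : ℝ) : ℂ) * Complex.I)) := by
    intro v
    have hxv : (n : ℂ) * ((a * v : ℝ) : ℂ) = x * v := by
      have : (n : ℝ) * (a * v) = x * v := by
        have : (n : ℝ) * a * x = x * x := by rw [mul_assoc, hax, hnt]; ring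
        have := mul_right_cancel₀ hx.ne' this
        rw [← mul_assoc, this]
      exact_mod_cast this
    have harg : (t : ℂ) + ((a * v : ℝ) : ℂ) * Complex.I =
        π ^ 2 / (6 * x ^ 2) * (1 + v / x * Complex.I) := by
      rw [ha, ht]; push_cast; field_simp
    rw [hxv, harg, saddleIntegrand]
    ring
  simp_rw [hpt]
  rw [intervalIntegral.integral_const_mul, hsub, Complex.real_smul]
  have he : Complex.exp (-(2 * x ^ 2)) = Complex.exp (-x ^ 2) * Complex.exp (-x ^ 2) := by
    rw [← Complex.exp_add]; congr 1; ring
  rw [he, ha]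
  push_cast
  field_simp
  ring

/-- The Hardy–Ramanujan asymptotic formula for the number of partitions. -/
theorem tendsto_card_partition_div :
    Tendsto (fun n : ℕ => (Fintype.card n.Partition : ℝ) /
        (1 / (4 * Real.sqrt 3 * (n : ℝ)) * Real.exp (π * Real.sqrt (2 * (n : ℝ) / 3))))
      atTop (nhds 1) := by
  set X : ℕ → ℝ := fun n => Real.sqrt (π * Real.sqrt (n / 6)) with hX
  have hXlim : Tendsto X atTop atTop := by
    refine tendsto_sqrt_atTop.comp (Tendsto.const_mul_atTop Real.pi_pos
      (tendsto_sqrt_atTop.comp (tendsto_natCast_atTop_atTop.atTop_div_const (by norm_num))))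
  have h := tendsto_integral_saddleIntegrand.comp hXlim
  have h' := (Complex.continuous_re.tendsto _).comp h
  simp only [Complex.ofReal_re] at h'
  have h2 := h'.div_const (Real.sqrt (π / 12) * Real.sqrt π)
  rw [div_self (by positivity)] at h2
  refine h2.congr' ?_
  filter_upwards [eventually_gt_atTop 0] with n hn
  have hn0 : (0 : ℝ) < n := by exact_mod_cast hn
  have hXpos : 0 < X n := by simp only [hX]; positivity
  have hX2 : X n ^ 2 = π * Real.sqrt (n / 6) := Real.sq_sqrt (by positivity)
  have hX4 : X n ^ 4 = π ^ 2 * n / 6 := by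
    rw [show X n ^ 4 = (X n ^ 2) ^ 2 by ring, hX2, mul_pow, Real.sq_sqrt (by positivity)]
    ring
  have hint := card_partition_eq_integral_saddleIntegrand hXpos hX4
  simp only [Function.comp, ← hint]
  have hcast : (Fintype.card n.Partition : ℂ) * Complex.exp (-(2 * (X n : ℂ) ^ 2)) *
      (12 * (X n : ℂ) ^ 4 / π) = ((Fintype.card n.Partition * Real.exp (-(2 * X n ^ 2)) *
      (12 * X n ^ 4 / π) : ℝ) : ℂ) := by push_cast; rfl
  rw [hcast, Complex.ofReal_re, hX4, hX2, Real.exp_neg]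
  have e1 : 2 * (π * Real.sqrt (n / 6)) = π * Real.sqrt (2 * n / 3) := by
    rw [show (2 * n / 3 : ℝ) = 2 ^ 2 * (n / 6) by ring, Real.sqrt_mul (by norm_num),
      Real.sqrt_sq two_pos.le]
    ring
  have e2 : Real.sqrt (π / 12) * Real.sqrt π = π / (2 * Real.sqrt 3) := by
    rw [← Real.sqrt_mul (by positivity), show π / 12 * π = (π / 2) ^ 2 / 3 by ring,
      Real.sqrt_div (by positivity), Real.sqrt_sq (by positivity)]
    field_simp
  rw [e1, e2]
  field_simp
  ring

lemma le_largestPart {n : ℕ} {P : n.Partition} {j : ℕ} (h : j ∈ P.parts) : j ≤ largestPart P :=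
  Multiset.le_sup h

lemma largestPart_mem {n : ℕ} (hn : 0 < n) (P : n.Partition) : largestPart P ∈ P.parts := by
  have hne : P.parts.toFinset.Nonempty := by
    rw [Multiset.toFinset_nonempty]
    intro h0
    have := P.parts_sum
    simp [h0] at this
    omega
  obtain ⟨x, hx, hmax⟩ := P.parts.toFinset.exists_max_image id hne
  simp only [Multiset.mem_toFinset, id] at hx hmax
  have : largestPart P = x := le_antisymm (Multiset.sup_le.2 hmax) (le_largestPart hx)
  rwa [this]

lemma maex_lt_largestPart {n : ℕ} (hn : 0 < n) (P : n.Partition) : maex P < largestPart P := by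
  have h1 := P.parts_pos (largestPart_mem hn P)
  have h2 : maex P ≤ largestPart P - 1 := Nat.findGreatest_le _
  omega

lemma mem_parts_of_maex_lt {n : ℕ} (hn : 0 < n) {P : n.Partition} {j : ℕ} (h1 : maex P < j)
    (h2 : j ≤ largestPart P) : j ∈ P.parts := by
  rcases h2.eq_or_lt with rfl | h2
  · exact largestPart_mem hn P
  · by_contra hj
    exact Nat.findGreatest_is_greatest h1 (by omega) hj

lemma cons_eq_cons_of_forall_le {x y : ℕ} {R S : Multiset ℕ} (hR : ∀ z ∈ R, z ≤ x)
    (hS : ∀ z ∈ S, z ≤ y) (h : x ::ₘ R = y ::ₘ S) : x = y ∧ R = S := by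
  have hxy : x = y := by
    apply le_antisymm
    · have : x ∈ y ::ₘ S := h ▸ Multiset.mem_cons_self x R
      rcases Multiset.mem_cons.1 this with h | h
      exacts [h.le, hS x h]
    · have : y ∈ x ::ₘ R := h ▸ Multiset.mem_cons_self y S
      rcases Multiset.mem_cons.1 this with h | h
      exacts [h.le, hR y h]
  subst hxy
  exact ⟨rfl, Multiset.cons_inj_right _ |>.1 h⟩

/-- The partitions of `n` whose largest part exceeds the maximal excludant by at least `k`, so
that the `k` consecutive integers ending at the largest part all occur as parts. -/
def longRun (k n : ℕ) : Finset n.Partition := univ.filter fun P => k ≤ largestPart P - maex P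

/-- Replace one copy of the largest part `L` by `L + 2`. -/
def raiseLargest {n : ℕ} (hn : 0 < n) (P : n.Partition) : (n + 2).Partition where
  parts := (largestPart P + 2) ::ₘ P.parts.erase (largestPart P)
  parts_pos := by
    intro i hi
    rcases Multiset.mem_cons.1 hi with rfl | hi
    · omega
    · exact P.parts_pos (Multiset.mem_of_mem_erase hi)
  parts_sum := by
    have h := congrArg Multiset.sum (Multiset.cons_erase (largestPart_mem hn P))
    rw [Multiset.sum_cons, P.parts_sum] at h
    rw [Multiset.sum_cons]
    omega

lemma raiseLargest_injective {n : ℕ} (hn : 0 < n) :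
    Function.Injective (raiseLargest (n := n) hn) := by
  intro P Q h
  have h' := congrArg Nat.Partition.parts h
  have hb : ∀ P : n.Partition, ∀ z ∈ P.parts.erase (largestPart P), z ≤ largestPart P + 2 :=
    fun P z hz => (le_largestPart (Multiset.mem_of_mem_erase hz)).trans (by omega)
  obtain ⟨h1, h2⟩ := cons_eq_cons_of_forall_le (hb P) (hb Q) h'
  have h1 : largestPart P = largestPart Q := by omega
  apply Nat.Partition.ext
  rw [← Multiset.cons_erase (largestPart_mem hn P), ← Multiset.cons_erase (largestPart_mem hn Q),
    h2, h1]

lemma raiseLargest_notMem_longRun {n : ℕ} (hn : 0 < n) (P : n.Partition) :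
    raiseLargest hn P ∉ longRun 2 (n + 2) := by
  have hle : largestPart P + 2 ≤ largestPart (raiseLargest hn P) :=
    le_largestPart (Multiset.mem_cons_self _ _)
  have hge : largestPart (raiseLargest hn P) ≤ largestPart P + 2 := by
    refine Multiset.sup_le.2 fun j hj => ?_
    rcases Multiset.mem_cons.1 hj with rfl | hj
    · rfl
    · exact (le_largestPart (Multiset.mem_of_mem_erase hj)).trans (by omega)
  simp only [longRun, mem_filter, mem_univ, true_and]
  intro h
  have hmem : largestPart P + 1 ∈ (raiseLargest hn P).parts :=
    mem_parts_of_maex_lt (by omega) (by omega) (by omega)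
  rcases Multiset.mem_cons.1 hmem with h | h
  · omega
  · have := le_largestPart (Multiset.mem_of_mem_erase h)
    omega

lemma card_longRun_two_add_le {n : ℕ} (hn : 0 < n) :
    #(longRun 2 (n + 2)) + Fintype.card n.Partition ≤ Fintype.card (n + 2).Partition := by
  have hdisj : Disjoint (longRun 2 (n + 2)) (univ.image (raiseLargest hn)) := by
    rw [disjoint_right]
    intro Q hQ
    obtain ⟨P, -, rfl⟩ := mem_image.1 hQ
    exact raiseLargest_notMem_longRun hn P
  rw [← card_univ (α := n.Partition), ← card_image_of_injective _ (raiseLargest_injective hn),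
    ← card_union_of_disjoint hdisj]
  exact card_le_univ _

/-- The top four values `L, L - 1, L - 2, L - 3` of a partition with largest part `L`. -/
def topFour (L : ℕ) : Multiset ℕ := {L, L - 1, L - 2, L - 3}

lemma topFour_le_parts {n : ℕ} (hn : 0 < n) {P : n.Partition} (hP : P ∈ longRun 4 n) :
    topFour (largestPart P) ≤ P.parts := by
  simp only [longRun, mem_filter, mem_univ, true_and] at hP
  rw [topFour, Multiset.le_iff_subset]
  · intro j hj
    simp only [Multiset.insert_eq_cons, Multiset.mem_cons, Multiset.mem_singleton] at hj
    exact mem_parts_of_maex_lt hn (by omega) (by omega)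
  · simp only [Multiset.insert_eq_cons, Multiset.nodup_cons, Multiset.mem_cons,
      Multiset.mem_singleton, Multiset.nodup_singleton, and_true]
    omega

/-- The parts obtained from `P` by spreading its four largest values upwards by gaps `a, b, c`. -/
def spreadParts {n : ℕ} (P : n.Partition) (a b c : ℕ) : Multiset ℕ :=
  (largestPart P + a + b + c) ::ₘ (largestPart P + a + b) ::ₘ (largestPart P + a) ::ₘ
    largestPart P ::ₘ (P.parts - topFour (largestPart P))

lemma sum_spreadParts {n : ℕ} (hn : 0 < n) {P : n.Partition} (hP : P ∈ longRun 4 n)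
    (a b c : ℕ) : (spreadParts P a b c).sum = n + 6 + 3 * a + 2 * b + c := by
  have h := congrArg Multiset.sum (tsub_add_cancel_of_le (topFour_le_parts hn hP))
  rw [Multiset.sum_add, P.parts_sum] at h
  simp only [longRun, mem_filter, mem_univ, true_and] at hP
  simp only [topFour, Multiset.insert_eq_cons, Multiset.sum_cons, Multiset.sum_singleton] at h
  simp only [spreadParts, topFour, Multiset.insert_eq_cons, Multiset.sum_cons]
  omega

lemma spreadParts_pos {n : ℕ} (hn : 0 < n) {P : n.Partition} {a b c i : ℕ}
    (hi : i ∈ spreadParts P a b c) : 0 < i := by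
  have hL := P.parts_pos (largestPart_mem hn P)
  simp only [spreadParts, Multiset.mem_cons] at hi
  rcases hi with rfl | rfl | rfl | rfl | hi
  · omega
  · omega
  · omega
  · omega
  · exact P.parts_pos (Multiset.mem_of_le (Multiset.sub_le_self _ _) hi)

lemma spreadParts_inj {n : ℕ} (hn : 0 < n) {P Q : n.Partition} (hP : P ∈ longRun 4 n)
    (hQ : Q ∈ longRun 4 n) {a b c a' b' c' : ℕ} (h : spreadParts P a b c = spreadParts Q a' b' c') :
    P = Q ∧ a = a' ∧ b = b' ∧ c = c' := by
  have hb : ∀ P : n.Partition, ∀ z ∈ P.parts - topFour (largestPart P), z ≤ largestPart P :=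
    fun P z hz => le_largestPart (Multiset.mem_of_le (Multiset.sub_le_self _ _) hz)
  have hcons : ∀ {x y : ℕ} {R : Multiset ℕ}, (∀ z ∈ R, z ≤ x) → ∀ z ∈ x ::ₘ R, z ≤ x + y := by
    intro x y R hR z hz
    rcases Multiset.mem_cons.1 hz with rfl | hz
    · omega
    · exact (hR z hz).trans (by omega)
  have hb1 : ∀ (P : n.Partition) (a : ℕ), ∀ z ∈ largestPart P ::ₘ
      (P.parts - topFour (largestPart P)), z ≤ largestPart P + a := fun P a => hcons (hb P)
  have hb2 := fun (P : n.Partition) (a b : ℕ) => hcons (y := b) (hb1 P a)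
  have hb3 := fun (P : n.Partition) (a b c : ℕ) => hcons (y := c) (hb2 P a b)
  obtain ⟨e3, h⟩ := cons_eq_cons_of_forall_le (hb3 P a b c) (hb3 Q a' b' c') h
  obtain ⟨e2, h⟩ := cons_eq_cons_of_forall_le (hb2 P a b) (hb2 Q a' b') h
  obtain ⟨e1, h⟩ := cons_eq_cons_of_forall_le (hb1 P a) (hb1 Q a') h
  obtain ⟨e0, h⟩ := cons_eq_cons_of_forall_le (hb P) (hb Q) h
  refine ⟨?_, by omega, by omega, by omega⟩
  apply Nat.Partition.ext
  rw [← tsub_add_cancel_of_le (topFour_le_parts hn hP),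
    ← tsub_add_cancel_of_le (topFour_le_parts hn hQ), h, e0]

lemma card_longRun_four_mul_le {n : ℕ} (hn : 0 < n) (M : ℕ) :
    #(longRun 4 n) * M ^ 3 ≤ (6 * M + 1) * Fintype.card (n + 6 + 6 * M).Partition := by
  classical
  set S : Finset (n.Partition × ℕ × ℕ × ℕ) := longRun 4 n ×ˢ range M ×ˢ range M ×ˢ range M with hS
  set T : Finset (ℕ × Multiset ℕ) :=
    range (6 * M + 1) ×ˢ univ.image (fun P : (n + 6 + 6 * M).Partition => P.parts) with hT
  have hcS : #S = #(longRun 4 n) * M ^ 3 := by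
    simp only [hS, card_product, card_range]
    ring
  have hcT : #T = (6 * M + 1) * Fintype.card (n + 6 + 6 * M).Partition := by
    rw [hT, card_product, card_range,
      card_image_of_injective _ (fun P Q h => Nat.Partition.ext h), card_univ]
  rw [← hcS, ← hcT]
  refine card_le_card_of_injOn (fun x => (6 * M - 3 * x.2.1 - 2 * x.2.2.1 - x.2.2.2,
    spreadParts x.1 x.2.1 x.2.2.1 x.2.2.2 +
      Multiset.replicate (6 * M - 3 * x.2.1 - 2 * x.2.2.1 - x.2.2.2) 1)) ?_ ?_
  · rintro ⟨P, a, b, c⟩ hx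
    simp only [hS, coe_product, Set.mem_prod, mem_coe, mem_range] at hx
    obtain ⟨hP, ha, hb, hc⟩ := hx
    simp only [hT, coe_product, Set.mem_prod, mem_coe, mem_range, mem_image, mem_univ, true_and]
    refine ⟨by omega, ⟨_, ?_, ?_⟩, rfl⟩
    · intro i hi
      rcases Multiset.mem_add.1 hi with hi | hi
      · exact spreadParts_pos hn hi
      · rw [Multiset.eq_of_mem_replicate hi]
        exact one_pos
    · rw [Multiset.sum_add, sum_spreadParts hn hP, Multiset.sum_replicate, smul_eq_mul]
      omega
  · rintro ⟨P, a, b, c⟩ hx ⟨Q, a', b', c'⟩ hy hxy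
    simp only [hS, coe_product, Set.mem_prod, mem_coe, mem_range] at hx hy
    simp only [Prod.mk.injEq] at hxy
    obtain ⟨h1, h2⟩ := hxy
    rw [h1] at h2
    obtain ⟨rfl, rfl, rfl, rfl⟩ := spreadParts_inj hn hx.1 hy.1 (add_right_cancel h2)
    rfl

lemma sq_le_two_mul_sum (m r : ℕ) : r ^ 2 ≤ 2 * ∑ i ∈ range r, (m + 1 + i) := by
  induction r with
  | zero => simp
  | succ r ih =>
    rw [sum_range_succ]
    nlinarith

lemma sq_run_le {n : ℕ} (hn : 0 < n) (P : n.Partition) :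
    (largestPart P - maex P) ^ 2 ≤ 2 * n := by
  set r := largestPart P - maex P with hr
  refine (sq_le_two_mul_sum (maex P) r).trans (Nat.mul_le_mul_left 2 ?_)
  have hle : (Multiset.range r).map (fun i => maex P + 1 + i) ≤ P.parts := by
    rw [Multiset.le_iff_subset]
    · intro j hj
      obtain ⟨i, hi, rfl⟩ := Multiset.mem_map.1 hj
      rw [Multiset.mem_range] at hi
      exact mem_parts_of_maex_lt hn (by omega) (by omega)
    · exact (Multiset.nodup_range r).map (add_right_injective _)
  obtain ⟨u, hu⟩ := Multiset.le_iff_exists_add.1 hle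
  have h := P.parts_sum
  rw [hu, Multiset.sum_add] at h
  exact (Nat.le_add_right _ _).trans h.le

lemma sigmaL_eq_add {n : ℕ} (hn : 0 < n) :
    sigmaL n = sigmaMaex n + ∑ P : n.Partition, (largestPart P - maex P) := by
  rw [sigmaL, sigmaMaex, ← sum_add_distrib]
  exact sum_congr rfl fun P _ => (Nat.add_sub_cancel' (maex_lt_largestPart hn P).le).symm

lemma card_le_sum_run {n : ℕ} (hn : 0 < n) :
    Fintype.card n.Partition ≤ ∑ P : n.Partition, (largestPart P - maex P) := by
  rw [← card_univ, card_eq_sum_ones]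
  exact sum_le_sum fun P _ => Nat.sub_pos_of_lt (maex_lt_largestPart hn P)

lemma sum_run_le {n : ℕ} (hn : 0 < n) :
    ∑ P : n.Partition, (largestPart P - maex P) ≤
      Fintype.card n.Partition + 2 * #(longRun 2 n) + Nat.sqrt (2 * n) * #(longRun 4 n) := by
  rw [← card_univ, card_eq_sum_ones, longRun, longRun, card_filter, card_filter, mul_sum, mul_sum,
    ← sum_add_distrib, ← sum_add_distrib]
  refine sum_le_sum fun P _ => ?_
  have h : largestPart P - maex P ≤ Nat.sqrt (2 * n) := Nat.le_sqrt'.2 (sq_run_le hn P)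
  split_ifs <;> omega

/-- The Hardy–Ramanujan main term. -/
def hardyRamanujan (x : ℝ) : ℝ :=
  1 / (4 * Real.sqrt 3 * x) * Real.exp (π * Real.sqrt (2 * x / 3))

lemma hardyRamanujan_pos {x : ℝ} (hx : 0 < x) : 0 < hardyRamanujan x := by
  unfold hardyRamanujan
  positivity

lemma sqrt_add_le {x d : ℝ} (hx : 0 < x) (hd : 0 ≤ d) :
    Real.sqrt (2 * (x + d) / 3) ≤ Real.sqrt (2 * x / 3) + d / Real.sqrt x := by
  rw [Real.sqrt_le_left (by positivity)]
  have h1 : Real.sqrt x ≤ 3 * Real.sqrt (2 * x / 3) := by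
    rw [Real.sqrt_le_left (by positivity), mul_pow, Real.sq_sqrt (by positivity)]
    linarith
  have h2 : 1 / 3 ≤ Real.sqrt (2 * x / 3) / Real.sqrt x := by
    rw [div_le_div_iff₀ (by norm_num) (Real.sqrt_pos.2 hx)]
    linarith
  have h3 : (Real.sqrt (2 * x / 3) + d / Real.sqrt x) ^ 2 = 2 * x / 3 +
      2 * d * (Real.sqrt (2 * x / 3) / Real.sqrt x) + (d / Real.sqrt x) ^ 2 := by
    rw [add_sq, Real.sq_sqrt (by positivity)]
    ring
  rw [h3]
  nlinarith [sq_nonneg (d / Real.sqrt x)]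

lemma hardyRamanujan_add_le {x d : ℝ} (hx : 0 < x) (hd : 0 ≤ d) :
    hardyRamanujan (x + d) ≤ hardyRamanujan x * Real.exp (π * (d / Real.sqrt x)) := by
  unfold hardyRamanujan
  rw [mul_assoc (1 / (4 * Real.sqrt 3 * x)), ← Real.exp_add, ← mul_add]
  gcongr
  · linarith
  · exact sqrt_add_le hx hd

lemma le_hardyRamanujan_add {x d : ℝ} (hx : 0 < x) (hd : 0 ≤ d) :
    hardyRamanujan x * (x / (x + d)) ≤ hardyRamanujan (x + d) := by
  unfold hardyRamanujan
  have : 1 / (4 * Real.sqrt 3 * x) * Real.exp (π * Real.sqrt (2 * x / 3)) * (x / (x + d)) =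
      1 / (4 * Real.sqrt 3 * (x + d)) * Real.exp (π * Real.sqrt (2 * x / 3)) := by
    field_simp
  rw [this]
  gcongr
  linarith

lemma tendsto_hardyRamanujan_div_add_two :
    Tendsto (fun n : ℕ => hardyRamanujan n / hardyRamanujan (n + 2 : ℕ)) atTop (nhds 1) := by
  have hlow : Tendsto (fun n : ℕ => Real.exp (-(π * (2 / Real.sqrt n)))) atTop (nhds 1) := by
    have h : Tendsto (fun n : ℕ => (2 : ℝ) / Real.sqrt n) atTop (nhds 0) :=
      tendsto_const_nhds.div_atTop (Real.tendsto_sqrt_atTop.comp tendsto_natCast_atTop_atTop)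
    simpa [Function.comp_def] using (Real.continuous_exp.tendsto _).comp (h.const_mul π).neg
  have hup : Tendsto (fun n : ℕ => 1 + (2 : ℝ) / n) atTop (nhds 1) := by
    simpa using (tendsto_const_div_atTop_nhds_zero_nat (2 : ℝ)).const_add 1
  refine tendsto_of_tendsto_of_tendsto_of_le_of_le' hlow hup ?_ ?_
  · filter_upwards [eventually_gt_atTop 0] with n hn
    have hn' : (0 : ℝ) < n := by exact_mod_cast hn
    push_cast
    rw [le_div_iff₀ (hardyRamanujan_pos (by positivity)), Real.exp_neg,
      inv_mul_le_iff₀ (by positivity), mul_comm]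
    exact hardyRamanujan_add_le hn' zero_le_two
  · filter_upwards [eventually_gt_atTop 0] with n hn
    have hn' : (0 : ℝ) < n := by exact_mod_cast hn
    push_cast
    rw [div_le_iff₀ (hardyRamanujan_pos (by positivity))]
    have h := le_hardyRamanujan_add hn' zero_le_two
    calc hardyRamanujan n = (1 + 2 / n) * (hardyRamanujan n * (n / (n + 2))) := by field_simp
      _ ≤ _ := by gcongr

lemma tendsto_card_partition_div_hardyRamanujan :
    Tendsto (fun n : ℕ => (Fintype.card n.Partition : ℝ) / hardyRamanujan n) atTop (nhds 1) :=
  tendsto_card_partition_div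

lemma card_longRun_four_le {n : ℕ} (hn : 0 < n) :
    (Nat.sqrt (2 * n) * #(longRun 4 n) : ℝ) ≤
      56 / Real.sqrt n * Fintype.card (n + 6 + 6 * Nat.sqrt n).Partition := by
  set M := Nat.sqrt n with hM
  have hM1 : 1 ≤ M := Nat.le_sqrt'.2 (by omega)
  have h := card_longRun_four_mul_le hn M
  have hn' : (0 : ℝ) < n := by exact_mod_cast hn
  have h' : (#(longRun 4 n) : ℝ) * M ^ 3 ≤
      (6 * M + 1) * Fintype.card (n + 6 + 6 * M).Partition := by exact_mod_cast h
  have hM1' : (1 : ℝ) ≤ M := by exact_mod_cast hM1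
  have hp0 : (0 : ℝ) ≤ Fintype.card (n + 6 + 6 * M).Partition := Nat.cast_nonneg _
  generalize (Fintype.card (n + 6 + 6 * M).Partition : ℝ) = p at h' hp0 ⊢
  have hnM : (n : ℝ) ≤ 4 * M ^ 2 := by
    have h1 : n < (M + 1) ^ 2 := Nat.sqrt_lt'.1 (Nat.lt_succ_self _)
    have h2 : (M + 1) ^ 2 ≤ 4 * M ^ 2 := by nlinarith
    exact_mod_cast h1.le.trans h2
  have hsn : Real.sqrt n * Real.sqrt n = n := Real.mul_self_sqrt hn'.le
  have hs0 : 0 < Real.sqrt n := Real.sqrt_pos.2 hn'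
  have hs : (Nat.sqrt (2 * n) : ℝ) ≤ 2 * Real.sqrt n := by
    refine Real.nat_sqrt_le_real_sqrt.trans ?_
    rw [Real.sqrt_le_left (by positivity)]
    push_cast
    nlinarith
  have ha : (#(longRun 4 n) : ℝ) * M ^ 2 ≤ 7 * p := by
    have h1 : (#(longRun 4 n) : ℝ) * M ^ 2 * M ≤ 7 * p * M := by
      have h2 : p ≤ M * p := le_mul_of_one_le_left hp0 hM1'
      linarith
    exact le_of_mul_le_mul_right h1 (by linarith)
  have ha' : (#(longRun 4 n) : ℝ) * n ≤ 28 * p := by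
    have := mul_le_mul_of_nonneg_left hnM (Nat.cast_nonneg (α := ℝ) #(longRun 4 n))
    linarith
  calc (Nat.sqrt (2 * n) * #(longRun 4 n) : ℝ) ≤ 2 * Real.sqrt n * #(longRun 4 n) := by gcongr
    _ = 2 / Real.sqrt n * (#(longRun 4 n) * n) := by
      rw [div_mul_eq_mul_div, eq_div_iff hs0.ne', ← mul_assoc]
      linear_combination 2 * (#(longRun 4 n) : ℝ) * hsn
    _ ≤ 2 / Real.sqrt n * (28 * p) := by gcongr
    _ = 56 / Real.sqrt n * p := by ring

lemma hardyRamanujan_shift_le {n : ℕ} (hn : 0 < n) :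
    hardyRamanujan (n + 6 + 6 * Nat.sqrt n : ℕ) ≤ hardyRamanujan n * Real.exp (π * 12) := by
  have hn' : (1 : ℝ) ≤ n := by exact_mod_cast hn
  have h := hardyRamanujan_add_le (x := n) (d := 6 + 6 * Nat.sqrt n) (by linarith) (by positivity)
  push_cast
  rw [add_assoc]
  refine h.trans ?_
  have hpos := hardyRamanujan_pos (x := n) (by linarith)
  have hs1 : 1 ≤ Real.sqrt n := Real.one_le_sqrt.2 hn'
  have hs2 : (Nat.sqrt n : ℝ) ≤ Real.sqrt n := Real.nat_sqrt_le_real_sqrt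
  gcongr
  rw [div_le_iff₀ (by linarith)]
  linarith

lemma tendsto_card_longRun_four :
    Tendsto (fun n : ℕ => (Nat.sqrt (2 * n) * #(longRun 4 n) : ℝ) / hardyRamanujan n)
      atTop (nhds 0) := by
  have hlim : Tendsto (fun n : ℕ => 56 / Real.sqrt n * (2 * Real.exp (π * 12))) atTop (nhds 0) := by
    have h : Tendsto (fun n : ℕ => (56 : ℝ) / Real.sqrt n) atTop (nhds 0) :=
      tendsto_const_nhds.div_atTop (Real.tendsto_sqrt_atTop.comp tendsto_natCast_atTop_atTop)
    simpa using h.mul_const (2 * Real.exp (π * 12))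
  have hshift : Tendsto (fun n : ℕ => n + 6 + 6 * Nat.sqrt n) atTop atTop :=
    tendsto_atTop_mono (fun n => show n ≤ _ by omega) tendsto_id
  have hbd := hshift.eventually
    (tendsto_card_partition_div_hardyRamanujan.eventually_le_const one_lt_two)
  refine squeeze_zero' ?_ ?_ hlim
  · filter_upwards [eventually_gt_atTop 0] with n hn
    have := hardyRamanujan_pos (x := n) (by exact_mod_cast hn)
    positivity
  · filter_upwards [eventually_gt_atTop 0, hbd] with n hn hb
    have hpos := hardyRamanujan_pos (x := n) (by exact_mod_cast hn)
    rw [div_le_iff₀ (hardyRamanujan_pos (by positivity))] at hb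
    rw [div_le_iff₀ hpos]
    calc (Nat.sqrt (2 * n) * #(longRun 4 n) : ℝ)
        ≤ 56 / Real.sqrt n * Fintype.card (n + 6 + 6 * Nat.sqrt n).Partition :=
          card_longRun_four_le hn
      _ ≤ 56 / Real.sqrt n * (2 * (hardyRamanujan n * Real.exp (π * 12))) := by
          have := hardyRamanujan_shift_le hn
          gcongr
          linarith
      _ = _ := by ring

/-- As `n → ∞`,
`σL(n) − σmaex(n) ∼ (1/(4√3 n)) e^{π √(2n/3)}`, i.e. the ratio tends to `1`. -/
theorem sigmaL_sub_sigmaMaex_asymptotic :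
    Tendsto (fun n : ℕ =>
        (((sigmaL n : ℤ) - (sigmaMaex n : ℤ) : ℤ) : ℝ) /
          (1 / (4 * Real.sqrt 3 * (n : ℝ)) * Real.exp (π * Real.sqrt (2 * (n : ℝ) / 3))))
      atTop (nhds 1) := by
  have hp := tendsto_card_partition_div_hardyRamanujan
  have hp2 : Tendsto (fun n : ℕ => (Fintype.card n.Partition : ℝ) / hardyRamanujan (n + 2 : ℕ))
      atTop (nhds 1) := by
    have h := hp.mul tendsto_hardyRamanujan_div_add_two
    rw [one_mul] at h
    refine h.congr' ?_
    filter_upwards [eventually_gt_atTop 0] with n hn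
    exact div_mul_div_cancel₀ (hardyRamanujan_pos (by exact_mod_cast hn)).ne'
  rw [← tendsto_add_atTop_iff_nat 2]
  have hup := ((((tendsto_add_atTop_iff_nat 2).2 hp).const_mul 3).sub (hp2.const_mul 2)).add
    ((tendsto_add_atTop_iff_nat 2).2 tendsto_card_longRun_four)
  rw [show (3 * 1 - 2 * 1 + 0 : ℝ) = 1 by norm_num] at hup
  refine tendsto_of_tendsto_of_tendsto_of_le_of_le'
    ((tendsto_add_atTop_iff_nat 2).2 hp) hup (Eventually.of_forall fun n => ?_) ?_
  · have hpos : 0 < hardyRamanujan (n + 2 : ℕ) := hardyRamanujan_pos (by positivity)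
    refine (div_le_div_iff_of_pos_right hpos).2 ?_
    have h := card_le_sum_run (n := n + 2) (by omega)
    rw [sigmaL_eq_add (by omega)]
    push_cast
    rw [add_sub_cancel_left]
    exact_mod_cast h
  · filter_upwards [eventually_gt_atTop 0] with n hn
    have hpos : 0 < hardyRamanujan (n + 2 : ℕ) := hardyRamanujan_pos (by positivity)
    rw [← mul_div_assoc, ← mul_div_assoc, ← sub_div, ← add_div]
    refine (div_le_div_iff_of_pos_right hpos).2 ?_
    have h := sum_run_le (n := n + 2) (by omega)
    have h2 := card_longRun_two_add_le hn
    rw [sigmaL_eq_add (by omega)]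
    rw [Nat.cast_add, add_sub_cancel_left, Int.cast_natCast]
    have h' : ((∑ P : (n + 2).Partition, (largestPart P - maex P) : ℕ) : ℝ) ≤
        Fintype.card (n + 2).Partition + 2 * #(longRun 2 (n + 2)) +
          Nat.sqrt (2 * (n + 2)) * #(longRun 4 (n + 2)) := by exact_mod_cast h
    have h2' : (#(longRun 2 (n + 2)) : ℝ) + Fintype.card n.Partition ≤
        Fintype.card (n + 2).Partition := by exact_mod_cast h2
    linarith
end
end

section
/- Let E_n = (σL(n) − σmaex(n)) / p(n) denote the expectation of L(π) − maex(π) over all partitions π of n. Then lim_{n→∞} E_n = 1. -/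
open Finset

noncomputable section

open Filter

namespace Nat.Partition

variable {n : ℕ}

lemma le_largestPart {π : n.Partition} {i : ℕ} (hi : i ∈ π.parts) : i ≤ largestPart π :=
  Multiset.le_sup hi

lemma exists_mem_eq_multisetSup {s : Multiset ℕ} (hs : s ≠ 0) : s.sup ∈ s := by
  induction s using Multiset.induction with
  | empty => exact absurd rfl hs
  | cons a s ih =>
    rw [Multiset.sup_cons]
    by_cases h : s = 0
    · simp [h]
    · rcases le_total a s.sup with h' | h'
      · rw [sup_eq_right.2 h']
        exact Multiset.mem_cons_of_mem (ih h)
      · rw [sup_eq_left.2 h']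
        exact Multiset.mem_cons_self a s

lemma parts_ne_zero (hn : n ≠ 0) (π : n.Partition) : π.parts ≠ 0 := by
  intro h
  have := π.parts_sum
  simp [h] at this
  exact hn this.symm

lemma largestPart_mem (hn : n ≠ 0) (π : n.Partition) : largestPart π ∈ π.parts :=
  exists_mem_eq_multisetSup (parts_ne_zero hn π)

lemma maex_lt_largestPart (hn : n ≠ 0) (π : n.Partition) : maex π < largestPart π := by
  have h1 : 0 < largestPart π := π.parts_pos (largestPart_mem hn π)
  have h2 : maex π ≤ largestPart π - 1 := Nat.findGreatest_le _
  omega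

lemma mem_parts_of_maex_lt (hn : n ≠ 0) (π : n.Partition) {i : ℕ} (h1 : maex π < i)
    (h2 : i ≤ largestPart π) : i ∈ π.parts := by
  rcases h2.eq_or_lt with rfl | h2
  · exact largestPart_mem hn π
  · by_contra h
    exact Nat.findGreatest_is_greatest (P := fun j => j ∉ π.parts) h1 (by omega) h

lemma largestPart_sub_maex_le_card (hn : n ≠ 0) (π : n.Partition) :
    largestPart π - maex π ≤ #π.parts.toFinset := by
  rw [← Nat.card_Ioc]
  refine card_le_card fun i hi => ?_
  rw [Finset.mem_Ioc] at hi
  exact Multiset.mem_toFinset.2 (mem_parts_of_maex_lt hn π hi.1 hi.2)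

/-- A family of pairs (partition, choice) that is encoded injectively by a partition and one of
`c` labels has at most `c * p(n)` members. -/
lemma sum_card_le_of_encoding {α : Type*} (c : ℕ) (A : Finset n.Partition)
    (X : n.Partition → Finset α) (e : n.Partition → α → Multiset ℕ × ℕ)
    (h_pos : ∀ π ∈ A, ∀ x ∈ X π, ∀ i ∈ (e π x).1, 0 < i)
    (h_sum : ∀ π ∈ A, ∀ x ∈ X π, (e π x).1.sum = n)
    (h_lt : ∀ π ∈ A, ∀ x ∈ X π, (e π x).2 < c)
    (h_inj : ∀ π ∈ A, ∀ x ∈ X π, ∀ π' ∈ A, ∀ x' ∈ X π', e π x = e π' x' →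
      π.parts = π'.parts ∧ x = x') :
    ∑ π ∈ A, #(X π) ≤ c * Fintype.card n.Partition := by
  classical
  rw [← Finset.card_sigma]
  calc #(A.sigma X) ≤ #((univ.image (parts : n.Partition → Multiset ℕ)) ×ˢ range c) := by
        refine card_le_card_of_injOn (fun p => e p.1 p.2) ?_ ?_
        · rintro ⟨π, x⟩ h
          simp only [coe_sigma, Set.mem_sigma_iff, mem_coe] at h
          simp only [coe_product, Set.mem_prod, mem_coe, mem_image, mem_univ, true_and, mem_range]
          exact ⟨⟨⟨_, fun {i} hi => h_pos π h.1 x h.2 i hi, h_sum π h.1 x h.2⟩, rfl⟩,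
            h_lt π h.1 x h.2⟩
        · rintro ⟨π, x⟩ h ⟨π', x'⟩ h' he
          simp only [coe_sigma, Set.mem_sigma_iff, mem_coe] at h h'
          obtain ⟨h1, rfl⟩ := h_inj π h.1 x h.2 π' h'.1 x' h'.2 he
          obtain rfl := Nat.Partition.ext h1
          rfl
    _ ≤ c * Fintype.card n.Partition := by
        rw [card_product, card_range, mul_comm]
        exact Nat.mul_le_mul_left _ Finset.card_image_le

lemma cons_injective_of_le {a b : ℕ} {s t : Multiset ℕ} (ha : ∀ i ∈ s, i ≤ a)
    (hb : ∀ i ∈ t, i ≤ b) (h : a ::ₘ s = b ::ₘ t) : a = b ∧ s = t := by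
  have hab : a = b := by
    have := congrArg Multiset.sup h
    rwa [Multiset.sup_cons, Multiset.sup_cons, sup_eq_left.2 (Multiset.sup_le.2 ha),
      sup_eq_left.2 (Multiset.sup_le.2 hb)] at this
  subst hab
  exact ⟨rfl, (Multiset.cons_inj_right a).1 h⟩

/-- The distinct part sizes of `π` smaller than `largestPart π - k`. -/
def smallParts (k : ℕ) (π : n.Partition) : Finset ℕ :=
  {i ∈ π.parts.toFinset | i + k < largestPart π}

lemma mem_smallParts {k i : ℕ} {π : n.Partition} :
    i ∈ smallParts k π ↔ i ∈ π.parts ∧ i + k < largestPart π := by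
  simp [smallParts]

lemma card_toFinset_le_card_smallParts (k : ℕ) (π : n.Partition) :
    #π.parts.toFinset ≤ #(smallParts k π) + (k + 1) := by
  calc #π.parts.toFinset
      ≤ #(smallParts k π ∪ Icc (largestPart π - k) (largestPart π)) := by
        refine card_le_card fun i hi => ?_
        rw [Multiset.mem_toFinset] at hi
        have := le_largestPart hi
        rw [mem_union, mem_smallParts, Finset.mem_Icc]
        by_cases h : i + k < largestPart π
        · exact Or.inl ⟨hi, h⟩
        · right; omega
    _ ≤ #(smallParts k π) + #(Icc (largestPart π - k) (largestPart π)) := card_union_le _ _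
    _ ≤ _ := by
        rw [Nat.card_Icc]
        omega

/-- Merging a small part into the largest part. -/
lemma sum_card_smallParts_one_le (A : Finset n.Partition)
    (hA : ∀ π ∈ A, largestPart π - 1 ∈ π.parts) :
    ∑ π ∈ A, #(smallParts 1 π) ≤ 2 * Fintype.card n.Partition := by
  set rest : n.Partition → ℕ → Multiset ℕ :=
    fun π x => (π.parts.erase (largestPart π)).erase x with hrest
  have key : ∀ π ∈ A, ∀ x ∈ smallParts 1 π,
      π.parts = largestPart π ::ₘ x ::ₘ rest π x ∧ largestPart π - 1 ≤ (rest π x).sup ∧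
        (rest π x).sup ≤ largestPart π ∧ 0 < x ∧ x + 1 < largestPart π := by
    intro π hπ x hx
    rw [mem_smallParts] at hx
    have hn : n ≠ 0 := by
      rintro rfl
      have := le_of_mem_parts hx.1
      have := π.parts_pos hx.1
      omega
    refine ⟨?_, ?_, ?_, π.parts_pos hx.1, hx.2⟩
    · rw [hrest, Multiset.cons_erase, Multiset.cons_erase (largestPart_mem hn π)]
      exact (Multiset.mem_erase_of_ne (by omega)).2 hx.1
    · refine Multiset.le_sup ?_
      rw [hrest, Multiset.mem_erase_of_ne (by omega), Multiset.mem_erase_of_ne (by omega)]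
      exact hA π hπ
    · refine Multiset.sup_le.2 fun i hi => le_largestPart ?_
      exact Multiset.mem_of_mem_erase (Multiset.mem_of_mem_erase hi)
  have mem_rest : ∀ π x, ∀ i ∈ rest π x, i ∈ π.parts := fun π x i hi =>
    Multiset.mem_of_mem_erase (Multiset.mem_of_mem_erase hi)
  refine sum_card_le_of_encoding 2 A (smallParts 1)
    (fun π x => ((largestPart π + x) ::ₘ rest π x, largestPart π - (rest π x).sup)) ?_ ?_ ?_ ?_
  · intro π hπ x hx i hi
    obtain ⟨-, -, -, h4, -⟩ := key π hπ x hx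
    rcases Multiset.mem_cons.1 hi with rfl | hi
    · omega
    · exact π.parts_pos (mem_rest π x i hi)
  · intro π hπ x hx
    have := congrArg Multiset.sum (key π hπ x hx).1
    rw [π.parts_sum, Multiset.sum_cons, Multiset.sum_cons] at this
    rw [Multiset.sum_cons]
    omega
  · intro π hπ x hx
    have := key π hπ x hx
    dsimp only
    omega
  · intro π hπ x hx π' hπ' x' hx' he
    obtain ⟨h1, h2, h3, h4, h5⟩ := key π hπ x hx
    obtain ⟨h1', h2', h3', h4', h5'⟩ := key π' hπ' x' hx'
    simp only [Prod.mk.injEq] at he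
    obtain ⟨e1, e2⟩ := cons_injective_of_le
      (fun i hi => (le_largestPart (mem_rest π x i hi)).trans (Nat.le_add_right _ _))
      (fun i hi => (le_largestPart (mem_rest π' x' i hi)).trans (Nat.le_add_right _ _)) he.1
    rw [e2] at he h2 h3
    have hL : largestPart π = largestPart π' := by omega
    have hx : x = x' := by omega
    rw [h1, h1', e2, hL, hx]
    exact ⟨rfl, rfl⟩

/-- Pairs of distinct small parts, in decreasing order. -/
def smallPairs (π : n.Partition) : Finset (ℕ × ℕ) :=
  {p ∈ smallParts 2 π ×ˢ smallParts 2 π | p.2 < p.1}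

lemma card_smallPairs (π : n.Partition) :
    #(smallParts 2 π) * #(smallParts 2 π) = 2 * #(smallPairs π) + #(smallParts 2 π) := by
  set X := smallParts 2 π
  have h1 : #{p ∈ X ×ˢ X | p.1 < p.2} = #(smallPairs π) := by
    refine card_bij (fun p _ => p.swap) ?_ ?_ ?_
    · rintro ⟨a, b⟩ h
      simp only [smallPairs, mem_filter, mem_product, Prod.swap] at h ⊢
      tauto
    · rintro ⟨a, b⟩ _ ⟨c, d⟩ _ h
      exact Prod.swap_injective h
    · rintro ⟨a, b⟩ h
      refine ⟨(b, a), ?_, rfl⟩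
      simp only [smallPairs, mem_filter, mem_product] at h ⊢
      tauto
  have h2 : X.offDiag = {p ∈ X ×ˢ X | p.1 < p.2} ∪ smallPairs π := by
    ext ⟨a, b⟩
    simp only [smallPairs, mem_offDiag, mem_union, mem_filter, mem_product, ne_iff_lt_or_gt]
    tauto
  have h3 : Disjoint {p ∈ X ×ˢ X | p.1 < p.2} (smallPairs π) := by
    rw [Finset.disjoint_left]
    rintro ⟨a, b⟩ h h'
    simp only [smallPairs, mem_filter] at h h'
    omega
  have h4 := offDiag_card X
  rw [h2, card_union_of_disjoint h3, h1] at h4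
  have : #X ≤ #X * #X := Nat.le_mul_self _
  omega

/-- Merging two small parts into the two largest parts. -/
lemma sum_card_smallPairs_le (A : Finset n.Partition)
    (hA : ∀ π ∈ A, largestPart π - 1 ∈ π.parts ∧ largestPart π - 2 ∈ π.parts) :
    ∑ π ∈ A, #(smallPairs π) ≤ 3 * Fintype.card n.Partition := by
  set rest : n.Partition → ℕ × ℕ → Multiset ℕ := fun π p =>
    (((π.parts.erase (largestPart π)).erase (largestPart π - 1)).erase p.1).erase p.2 with hrest
  have mem_rest : ∀ π p, ∀ i ∈ rest π p, i ∈ π.parts := fun π p i hi =>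
    Multiset.mem_of_mem_erase (Multiset.mem_of_mem_erase
      (Multiset.mem_of_mem_erase (Multiset.mem_of_mem_erase hi)))
  have key : ∀ π ∈ A, ∀ p ∈ smallPairs π,
      π.parts = largestPart π ::ₘ (largestPart π - 1) ::ₘ p.1 ::ₘ p.2 ::ₘ rest π p ∧
        largestPart π - 2 ≤ (rest π p).sup ∧ (rest π p).sup ≤ largestPart π ∧
        0 < p.2 ∧ p.2 < p.1 ∧ p.1 + 2 < largestPart π := by
    rintro π hπ ⟨x, y⟩ hp
    simp only [smallPairs, mem_filter, mem_product, mem_smallParts] at hp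
    obtain ⟨⟨⟨hx, hx'⟩, hy, hy'⟩, hyx⟩ := hp
    have hn : n ≠ 0 := by
      rintro rfl
      have := le_of_mem_parts hx
      have := π.parts_pos hx
      omega
    refine ⟨?_, ?_, ?_, π.parts_pos hy, hyx, hx'⟩
    · rw [hrest, Multiset.cons_erase, Multiset.cons_erase, Multiset.cons_erase,
        Multiset.cons_erase (largestPart_mem hn π)]
      · rw [Multiset.mem_erase_of_ne (by omega)]
        exact (hA π hπ).1
      · rwa [Multiset.mem_erase_of_ne (by dsimp only; omega),
          Multiset.mem_erase_of_ne (by dsimp only; omega)]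
      · rwa [Multiset.mem_erase_of_ne (by dsimp only; omega),
          Multiset.mem_erase_of_ne (by dsimp only; omega),
          Multiset.mem_erase_of_ne (by dsimp only; omega)]
    · refine Multiset.le_sup ?_
      rw [hrest, Multiset.mem_erase_of_ne (by dsimp only; omega),
        Multiset.mem_erase_of_ne (by dsimp only; omega),
        Multiset.mem_erase_of_ne (by omega), Multiset.mem_erase_of_ne (by omega)]
      exact (hA π hπ).2
    · exact Multiset.sup_le.2 fun i hi => le_largestPart (mem_rest π _ i hi)
  have le_snd : ∀ π ∈ A, ∀ p ∈ smallPairs π, ∀ i ∈ rest π p, i ≤ largestPart π - 1 + p.2 := by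
    intro π hπ p hp i hi
    have := key π hπ p hp
    have := le_largestPart (mem_rest π p i hi)
    omega
  have le_fst : ∀ π ∈ A, ∀ p ∈ smallPairs π, ∀ i ∈ (largestPart π - 1 + p.2) ::ₘ rest π p,
      i ≤ largestPart π + p.1 := by
    intro π hπ p hp i hi
    have := key π hπ p hp
    rcases Multiset.mem_cons.1 hi with rfl | hi
    · omega
    · have := le_largestPart (mem_rest π p i hi)
      omega
  refine sum_card_le_of_encoding 3 A smallPairs
    (fun π p => ((largestPart π + p.1) ::ₘ (largestPart π - 1 + p.2) ::ₘ rest π p,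
      largestPart π - (rest π p).sup)) ?_ ?_ ?_ ?_
  · intro π hπ p hp i hi
    have := key π hπ p hp
    rcases Multiset.mem_cons.1 hi with rfl | hi
    · omega
    rcases Multiset.mem_cons.1 hi with rfl | hi
    · omega
    · exact π.parts_pos (mem_rest π p i hi)
  · intro π hπ p hp
    have := congrArg Multiset.sum (key π hπ p hp).1
    simp only [π.parts_sum, Multiset.sum_cons] at this ⊢
    omega
  · intro π hπ p hp
    have := key π hπ p hp
    dsimp only
    omega
  · intro π hπ p hp π' hπ' p' hp' he
    obtain ⟨h1, h2, h3, h4, h5, h6⟩ := key π hπ p hp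
    obtain ⟨h1', h2', h3', h4', h5', h6'⟩ := key π' hπ' p' hp'
    simp only [Prod.mk.injEq] at he
    obtain ⟨e1, e2⟩ := cons_injective_of_le (le_fst π hπ p hp) (le_fst π' hπ' p' hp') he.1
    obtain ⟨e2, e3⟩ := cons_injective_of_le (le_snd π hπ p hp) (le_snd π' hπ' p' hp') e2
    rw [e3] at he h2 h3
    have hL : largestPart π = largestPart π' := by omega
    have hx : p.1 = p'.1 := by omega
    have hy : p.2 = p'.2 := by omega
    rw [h1, h1', e3, hL, hx, hy]
    exact ⟨rfl, Prod.ext hx hy⟩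

/-- The partitions of `n` with fewer than `T` distinct part sizes. -/
def fewSizes (n T : ℕ) : Finset n.Partition := {π | #π.parts.toFinset < T}

lemma mul_sub_maex_le (hn : n ≠ 0) {T : ℕ} (hT : 12 ≤ T) (π : n.Partition) :
    T * (largestPart π - maex π - 1) ≤
      (if #π.parts.toFinset < T then T * T else 0) +
      4 * (if maex π + 2 ≤ largestPart π then #(smallParts 1 π) else 0) +
      8 * (if maex π + 3 ≤ largestPart π then #(smallPairs π) else 0) := by
  have hd := largestPart_sub_maex_le_card hn π
  have h1 := card_toFinset_le_card_smallParts 1 π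
  have h2 := card_toFinset_le_card_smallParts 2 π
  have h3 := card_smallPairs π
  by_cases hdT : #π.parts.toFinset < T
  · have : T * (largestPart π - maex π - 1) ≤ T * T := Nat.mul_le_mul_left _ (by omega)
    rw [if_pos hdT]
    omega
  by_cases hr3 : maex π + 3 ≤ largestPart π
  · have : T * (largestPart π - maex π - 1) ≤ (#(smallParts 2 π) + 3) * (#(smallParts 2 π) + 3) :=
      Nat.mul_le_mul (by omega) (by omega)
    have : 9 ≤ #(smallParts 2 π) := by omega
    have : (#(smallParts 2 π) + 3) * (#(smallParts 2 π) + 3) ≤ 8 * #(smallPairs π) := by nlinarith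
    rw [if_pos hr3]
    omega
  by_cases hr2 : maex π + 2 ≤ largestPart π
  · have : largestPart π - maex π - 1 = 1 := by omega
    rw [this, if_pos hr2]
    omega
  · have : largestPart π - maex π - 1 = 0 := by omega
    simp [this]

lemma mul_sum_sub_maex_le (hn : n ≠ 0) {T : ℕ} (hT : 12 ≤ T) :
    T * ∑ π : n.Partition, (largestPart π - maex π - 1) ≤
      T * T * #(fewSizes n T) + 32 * Fintype.card n.Partition := by
  have h2 : ∑ π : n.Partition with maex π + 2 ≤ largestPart π, #(smallParts 1 π) ≤
      2 * Fintype.card n.Partition := by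
    refine sum_card_smallParts_one_le _ fun π hπ => ?_
    rw [mem_filter] at hπ
    exact mem_parts_of_maex_lt hn π (by omega) (by omega)
  have h3 : ∑ π : n.Partition with maex π + 3 ≤ largestPart π, #(smallPairs π) ≤
      3 * Fintype.card n.Partition := by
    refine sum_card_smallPairs_le _ fun π hπ => ?_
    rw [mem_filter] at hπ
    exact ⟨mem_parts_of_maex_lt hn π (by omega) (by omega),
      mem_parts_of_maex_lt hn π (by omega) (by omega)⟩
  have h := sum_le_sum fun π (_ : π ∈ (univ : Finset n.Partition)) => mul_sub_maex_le hn hT π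
  rw [← mul_sum, sum_add_distrib, sum_add_distrib, ← mul_sum, ← mul_sum, ← sum_filter,
    ← sum_filter, ← sum_filter, sum_const, smul_eq_mul, mul_comm _ (T * T)] at h
  rw [fewSizes]
  omega

lemma card_fewSizes_le (n T : ℕ) : #(fewSizes n T) ≤ T * ((n + 1) ^ 2) ^ T := by
  set B := range (n + 1) ×ˢ range (n + 1)
  have hB : #B = (n + 1) ^ 2 := by rw [card_product, card_range, sq]
  calc #(fewSizes n T) ≤ #((range T).biUnion fun j => B.powersetCard j) := by
        refine card_le_card_of_injOn (fun π => (Multiset.toFinsupp π.parts).graph) ?_ ?_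
        · intro π hπ
          rw [mem_coe, fewSizes, mem_filter] at hπ
          simp only [mem_coe, mem_biUnion, mem_range, mem_powersetCard]
          refine ⟨_, hπ.2, ?_, ?_⟩
          · rintro ⟨a, b⟩ hab
            rw [Finsupp.mk_mem_graph_iff, Multiset.toFinsupp_apply] at hab
            obtain ⟨rfl, hb⟩ := hab
            have ha : a ∈ π.parts := Multiset.count_ne_zero.1 hb
            have h1 : Multiset.count a π.parts ≤ n := by
              have h2 : Multiset.card π.parts • 1 ≤ π.parts.sum :=
                Multiset.card_nsmul_le_sum fun x hx => π.parts_pos hx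
              have h3 := Multiset.count_le_card a π.parts
              rw [π.parts_sum, smul_eq_mul] at h2
              omega
            have h4 := le_of_mem_parts ha
            simp only [B, mem_product, mem_range]
            omega
          · rw [Finsupp.graph, card_map, Multiset.toFinsupp_support]
        · intro π _ π' _ h
          exact Nat.Partition.ext (Multiset.toFinsupp.injective (Finsupp.graph_injective _ _ h))
    _ ≤ #(range T) * ((n + 1) ^ 2) ^ T := by
        refine card_biUnion_le_card_mul _ _ _ fun j hj => ?_
        rw [card_powersetCard, hB]
        exact (Nat.choose_le_pow _ _).trans
          (Nat.pow_le_pow_right (by positivity) (Finset.mem_range.1 hj).le)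
    _ = T * ((n + 1) ^ 2) ^ T := by rw [card_range]

lemma two_pow_le_card {m : ℕ} (h : m * m ≤ n) : 2 ^ (m - 1) ≤ Fintype.card n.Partition := by
  have sum_le : ∀ S ∈ (Icc 2 m).powerset, S.val.sum ≤ n := by
    intro S hS
    rw [mem_powerset] at hS
    have h1 : S.sum id ≤ #S • m := sum_le_card_nsmul _ _ _ fun i hi => (Finset.mem_Icc.1 (hS hi)).2
    have h2 : #S ≤ m := by
      have := card_le_card hS
      rw [Nat.card_Icc] at this
      omega
    rw [sum_val]
    exact h1.trans ((Nat.mul_le_mul_right m h2).trans h)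
  calc 2 ^ (m - 1) = #(Icc 2 m).powerset := by
        rw [card_powerset, Nat.card_Icc]
        congr 1
    _ ≤ #(univ.image (parts : n.Partition → Multiset ℕ)) := by
        refine card_le_card_of_injOn (fun S => S.val + Multiset.replicate (n - S.val.sum) 1) ?_ ?_
        · intro S hS
          have h1 := sum_le S hS
          rw [mem_coe, mem_powerset] at hS
          simp only [mem_coe, mem_image, mem_univ, true_and]
          refine ⟨⟨_, fun {i} hi => ?_, ?_⟩, rfl⟩
          · rcases Multiset.mem_add.1 hi with hi | hi
            · have := Finset.mem_Icc.1 (hS hi)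
              omega
            · rw [Multiset.eq_of_mem_replicate hi]
              exact one_pos
          · rw [Multiset.sum_add, Multiset.sum_replicate, smul_eq_mul]
            omega
        · intro S hS S' hS' hSS'
          have mem_iff : ∀ U ∈ (Icc 2 m).powerset, ∀ i, i ∈ U ↔
              2 ≤ i ∧ i ∈ U.val + Multiset.replicate (n - U.val.sum) 1 := by
            intro U hU i
            rw [mem_powerset] at hU
            rw [Multiset.mem_add, mem_val]
            constructor
            · intro hi
              exact ⟨(Finset.mem_Icc.1 (hU hi)).1, Or.inl hi⟩
            · rintro ⟨h2, hi | hi⟩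
              · exact hi
              · have := Multiset.eq_of_mem_replicate hi
                omega
          ext i
          dsimp only at hSS'
          rw [mem_iff S hS, mem_iff S' hS', hSS']
    _ ≤ Fintype.card n.Partition := Finset.card_image_le

lemma tendsto_natSqrt_atTop : Tendsto Nat.sqrt atTop atTop :=
  tendsto_atTop_atTop.2 fun b => ⟨b * b, fun _ ha => Nat.le_sqrt.2 ha⟩

lemma card_pos (n : ℕ) : 0 < Fintype.card n.Partition := Fintype.card_pos

lemma tendsto_card_fewSizes_div (T : ℕ) :
    Tendsto (fun n : ℕ => (#(fewSizes n T) : ℝ) / Fintype.card n.Partition) atTop (nhds 0) := by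
  have h1 := (tendsto_pow_const_div_const_pow_of_one_lt (4 * T) (one_lt_two (α := ℝ))).comp
    ((tendsto_add_atTop_nat 1).comp tendsto_natSqrt_atTop)
  have h2 := h1.const_mul (4 * T : ℝ)
  rw [mul_zero] at h2
  refine squeeze_zero (fun n => by positivity) (fun n => ?_) h2
  have hp : (0 : ℝ) < Fintype.card n.Partition := by exact_mod_cast card_pos n
  simp only [Function.comp_apply]
  have hlow : (2 : ℝ) ^ (n.sqrt + 1) ≤ 4 * Fintype.card n.Partition := by
    have h3 : 2 ^ (n.sqrt + 1) ≤ 4 * 2 ^ (n.sqrt - 1) := by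
      rw [show 4 = 2 ^ 2 from rfl, ← pow_add]
      exact Nat.pow_le_pow_right two_pos (by omega)
    exact_mod_cast h3.trans (Nat.mul_le_mul_left 4 (two_pow_le_card (Nat.sqrt_le n)))
  have hup : (#(fewSizes n T) : ℝ) ≤ T * ((n.sqrt + 1 : ℕ) : ℝ) ^ (4 * T) := by
    have h4 : n + 1 ≤ (n.sqrt + 1) ^ 2 := by
      have := Nat.lt_succ_sqrt n
      rw [sq]
      exact this
    have h5 : ((n + 1) ^ 2) ^ T ≤ (n.sqrt + 1) ^ (4 * T) := by
      rw [← pow_mul, show 4 * T = 2 * (2 * T) by ring, pow_mul (n.sqrt + 1)]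
      exact Nat.pow_le_pow_left h4 _
    exact_mod_cast (card_fewSizes_le n T).trans (Nat.mul_le_mul_left T h5)
  rw [div_le_iff₀ hp, mul_div_assoc', div_mul_eq_mul_div, le_div_iff₀ (by positivity)]
  calc (#(fewSizes n T) : ℝ) * 2 ^ (n.sqrt + 1)
      ≤ (T * ((n.sqrt + 1 : ℕ) : ℝ) ^ (4 * T)) * (4 * Fintype.card n.Partition) := by gcongr
    _ = _ := by ring

lemma tendsto_sum_sub_maex_div :
    Tendsto (fun n : ℕ => ((∑ π : n.Partition, (largestPart π - maex π - 1) : ℕ) : ℝ) /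
      Fintype.card n.Partition) atTop (nhds 0) := by
  rw [Metric.tendsto_atTop']
  intro ε hε
  obtain ⟨T, hT⟩ := exists_nat_gt (max 12 (64 / ε))
  have hT12 : 12 ≤ T := by exact_mod_cast ((le_max_left _ _).trans_lt hT).le
  have hTε : 64 / ε < T := (le_max_right _ _).trans_lt hT
  have hT0 : (0 : ℝ) < T := by
    have : 0 < T := by omega
    exact_mod_cast this
  have hsmall := (tendsto_card_fewSizes_div T).const_mul (T : ℝ)
  rw [mul_zero] at hsmall
  obtain ⟨N, hN⟩ := eventually_atTop.1 (hsmall.eventually_lt_const (half_pos hε))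
  refine ⟨N, fun n hnN => ?_⟩
  have hn : n ≠ 0 := by omega
  have hp : (0 : ℝ) < Fintype.card n.Partition := by exact_mod_cast card_pos n
  rw [Real.dist_eq, sub_zero, abs_of_nonneg (by positivity), div_lt_iff₀ hp]
  have h1 := hN n hnN.le
  rw [mul_div_assoc', div_lt_iff₀ hp] at h1
  rw [div_lt_iff₀ hε] at hTε
  have h2 : (T : ℝ) * ((∑ π : n.Partition, (largestPart π - maex π - 1) : ℕ) : ℝ) ≤
      T * T * #(fewSizes n T) + 32 * Fintype.card n.Partition := by
    exact_mod_cast mul_sum_sub_maex_le hn hT12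
  refine lt_of_mul_lt_mul_left (h2.trans_lt ?_) hT0.le
  nlinarith [mul_lt_mul_of_pos_left h1 hT0, mul_lt_mul_of_pos_right hTε hp]

lemma sigmaL_eq (hn : n ≠ 0) : sigmaL n = sigmaMaex n + Fintype.card n.Partition +
    ∑ π : n.Partition, (largestPart π - maex π - 1) := by
  rw [sigmaL, sigmaMaex, ← Finset.card_univ, card_eq_sum_ones, ← sum_add_distrib, ← sum_add_distrib]
  refine sum_congr rfl fun π _ => ?_
  have := maex_lt_largestPart hn π
  omega

end Nat.Partition

/-- The expectation
`E_n = (σL(n) − σmaex(n)) / p(n)` of `L(π) − maex(π)` over all partitions `π` of `n`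
tends to `1` as `n → ∞`; here `p(n)` is the number of partitions of `n`. -/
theorem expectation_tendsto_one :
    Tendsto (fun n : ℕ =>
        (((sigmaL n : ℤ) - (sigmaMaex n : ℤ) : ℤ) : ℝ) /
          (Fintype.card n.Partition : ℝ))
      atTop (nhds 1) := by
  have h := Nat.Partition.tendsto_sum_sub_maex_div.const_add 1
  rw [add_zero] at h
  refine h.congr' ?_
  filter_upwards [eventually_ne_atTop 0] with n hn
  have hp : (Fintype.card n.Partition : ℝ) ≠ 0 := by
    exact_mod_cast (Nat.Partition.card_pos n).ne'
  rw [Nat.Partition.sigmaL_eq hn]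
  push_cast
  field_simp
  ring
end
end

section
/- As t → 0⁺, the Dirichlet-type sum ∑_{n≥1} (σL(n) − σmaex(n)) e^{−nt} is asymptotic to √(t/(2π)) · e^{π²/(6t)}, i.e., their ratio tends to 1. -/
open Finset

noncomputable section

/-- The generating function, in `ℝ≥0∞`, of multisets of integers in `[1, L]` by their sum. -/
def boundedGenFun (x : ENNReal) (L : ℕ) : ENNReal :=
  ∑' m : {m : Multiset ℕ // ∀ i ∈ m, 0 < i ∧ i ≤ L}, x ^ m.1.sum

theorem boundedGenFun_zero (x : ENNReal) : boundedGenFun x 0 = 1 := by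
  have h : ∀ m : {m : Multiset ℕ // ∀ i ∈ m, 0 < i ∧ i ≤ 0}, m = ⟨0, by simp⟩ := by
    rintro ⟨m, hm⟩
    simp only [Subtype.mk.injEq]
    refine Multiset.eq_zero_of_forall_notMem fun i hi => ?_
    have := hm i hi
    omega
  rw [boundedGenFun, tsum_eq_single ⟨0, by simp⟩ fun m hm => absurd (h m) hm]
  simp

theorem boundedGenFun_succ (x : ENNReal) (L : ℕ) :
    boundedGenFun x (L + 1) = (1 - x ^ (L + 1))⁻¹ * boundedGenFun x L := by
  let g : ℕ × {m : Multiset ℕ // ∀ i ∈ m, 0 < i ∧ i ≤ L} →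
      {m : Multiset ℕ // ∀ i ∈ m, 0 < i ∧ i ≤ L + 1} := fun p =>
    ⟨Multiset.replicate p.1 (L + 1) + p.2.1, by
      intro i hi
      rcases Multiset.mem_add.1 hi with h | h
      · rw [Multiset.eq_of_mem_replicate h]
        omega
      · have := p.2.2 i h
        omega⟩
  have hcount : ∀ m : {m : Multiset ℕ // ∀ i ∈ m, 0 < i ∧ i ≤ L}, m.1.count (L + 1) = 0 := by
    intro m
    refine Multiset.count_eq_zero_of_notMem fun h => ?_
    have := m.2 _ h
    omega
  have hg : Function.Bijective g := by
    constructor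
    · rintro ⟨k, m⟩ ⟨k', m'⟩ h
      have h1 : Multiset.replicate k (L + 1) + m.1 = Multiset.replicate k' (L + 1) + m'.1 :=
        congrArg Subtype.val h
      have h2 := congrArg (Multiset.count (L + 1)) h1
      simp only [Multiset.count_add, Multiset.count_replicate_self, hcount, add_zero] at h2
      subst h2
      rw [Multiset.add_right_inj] at h1
      rw [Subtype.ext h1]
    · rintro ⟨m, hm⟩
      refine ⟨⟨m.count (L + 1), ⟨m.filter (fun i => ¬ i = L + 1), ?_⟩⟩, ?_⟩
      · intro i hi
        rw [Multiset.mem_filter] at hi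
        have := hm i hi.1
        omega
      · apply Subtype.ext
        change Multiset.replicate (m.count (L + 1)) (L + 1) + m.filter (fun i => ¬ i = L + 1) = m
        rw [← Multiset.filter_eq', Multiset.filter_add_not]
  have hprod := ENNReal.tsum_prod (f := fun k m => x ^ (g (k, m)).1.sum)
  rw [boundedGenFun, ← (Equiv.ofBijective g hg).tsum_eq]
  refine hprod.trans ?_
  rw [← ENNReal.tsum_geometric,
    boundedGenFun, ← ENNReal.tsum_mul_right]
  refine tsum_congr fun k => ?_
  rw [← ENNReal.tsum_mul_left]
  refine tsum_congr fun m => ?_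
  simp only [g, Multiset.sum_add, Multiset.sum_replicate, smul_eq_mul]
  ring

theorem boundedGenFun_eq_prod (x : ENNReal) (L : ℕ) :
    boundedGenFun x L = ∏ i ∈ range L, (1 - x ^ (i + 1))⁻¹ := by
  induction L with
  | zero => simp [boundedGenFun_zero]
  | succ L ih => rw [boundedGenFun_succ, ih, prod_range_succ, mul_comm]

theorem le_largestPart_s17 {n : ℕ} (π : n.Partition) {i : ℕ} (hi : i ∈ π.parts) :
    i ≤ largestPart π :=
  Multiset.le_sup hi

theorem largestPart_mem_s17 {n : ℕ} (π : n.Partition) (h : 0 < largestPart π) :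
    largestPart π ∈ π.parts := by
  have hne : π.parts.toFinset.Nonempty := by
    rw [Finset.nonempty_iff_ne_empty]
    intro h0
    rw [Multiset.toFinset_eq_empty] at h0
    simp [largestPart, h0] at h
  have hsup : π.parts.toFinset.sup id = largestPart π := by
    rw [Finset.sup_def, Multiset.map_id, Multiset.toFinset_val, Multiset.sup_dedup, largestPart]
  obtain ⟨i, hi, h'⟩ := Finset.exists_mem_eq_sup _ hne id
  rw [← hsup, h']
  simpa using hi

theorem Icc_subset_parts_iff {n : ℕ} (π : n.Partition) {j : ℕ} (hj : j ∈ Icc 1 (largestPart π)) :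
    Icc j (largestPart π) ⊆ π.parts.toFinset ↔ maex π < j := by
  rw [mem_Icc] at hj
  have hmaex : maex π ≤ largestPart π - 1 := Nat.findGreatest_le _
  constructor
  · intro h
    by_contra! hle
    have h1 : maex π ∉ π.parts :=
      Nat.findGreatest_spec (P := fun j => j ∉ π.parts) (Nat.zero_le (largestPart π - 1))
        fun h0 => absurd (π.parts_pos h0) (lt_irrefl 0)
    have h2 : maex π ∈ Icc j (largestPart π) := mem_Icc.2 ⟨hle, by omega⟩
    exact h1 (Multiset.mem_toFinset.1 (h h2))
  · intro h i hi
    rw [mem_Icc] at hi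
    rw [Multiset.mem_toFinset]
    rcases hi.2.eq_or_lt with rfl | hlt
    · exact largestPart_mem_s17 π (by omega)
    · by_contra hni
      exact Nat.findGreatest_is_greatest (P := fun j => j ∉ π.parts) (n := largestPart π - 1)
        (h.trans_le hi.1) (by omega) hni

theorem card_filter_Icc_subset_parts {n : ℕ} (π : n.Partition) :
    #{j ∈ Icc 1 (largestPart π) | Icc j (largestPart π) ⊆ π.parts.toFinset} =
      largestPart π - maex π := by
  rw [filter_congr fun j hj => Icc_subset_parts_iff π hj, ← Nat.card_Ioc]
  congr 1
  ext j
  simp only [mem_filter, mem_Icc, mem_Ioc]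
  omega

theorem natCast_largestPart_sub_maex {n : ℕ} (π : n.Partition) :
    ((largestPart π - maex π : ℕ) : ENNReal) = ∑' L : ℕ, ∑ j ∈ Icc 1 (L + 1),
      if largestPart π = L + 1 ∧ Icc j (L + 1) ⊆ π.parts.toFinset then 1 else 0 := by
  rcases Nat.eq_zero_or_pos (largestPart π) with h | h
  · simp [h]
  · obtain ⟨M, hM⟩ : ∃ M, largestPart π = M + 1 := ⟨largestPart π - 1, by omega⟩
    rw [tsum_eq_single M, ← card_filter_Icc_subset_parts, hM]
    · simp
    · intro L hL
      refine sum_eq_zero fun j _ => if_neg ?_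
      omega

theorem tsum_partition_Icc_subset (x : ENNReal) {L j : ℕ} (hj : j ∈ Icc 1 (L + 1)) :
    ∑' σ : Σ n : ℕ, n.Partition, (if largestPart σ.2 = L + 1 ∧
      Icc j (L + 1) ⊆ σ.2.parts.toFinset then 1 else 0) * x ^ σ.1 =
      x ^ (∑ i ∈ Icc j (L + 1), i) * boundedGenFun x (L + 1) := by
  rw [mem_Icc] at hj
  let g : {m : Multiset ℕ // ∀ i ∈ m, 0 < i ∧ i ≤ L + 1} → Σ n : ℕ, n.Partition := fun m =>
    ⟨(m.1 + (Icc j (L + 1)).val).sum, ⟨m.1 + (Icc j (L + 1)).val, by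
      intro i hi
      rcases Multiset.mem_add.1 hi with h | h
      · exact (m.2 i h).1
      · rw [Finset.mem_val, mem_Icc] at h
        omega, rfl⟩⟩
  have hparts : ∀ m, (g m).2.parts = m.1 + (Icc j (L + 1)).val := fun m => rfl
  have hext : ∀ σ τ : Σ n : ℕ, n.Partition, σ.2.parts = τ.2.parts → σ = τ := by
    rintro ⟨n, p, hp, rfl⟩ ⟨n', p', hp', rfl⟩ h
    simp only at h
    subst h
    rfl
  have hinj : Function.Injective g := by
    intro m m' h
    have h1 : m.1 + (Icc j (L + 1)).val = m'.1 + (Icc j (L + 1)).val := by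
      rw [← hparts, ← hparts, h]
    exact Subtype.ext ((Multiset.add_left_inj).1 h1)
  rw [← hinj.tsum_eq, boundedGenFun, ← ENNReal.tsum_mul_left]
  · refine tsum_congr fun m => ?_
    have hlarge : largestPart (g m).2 = L + 1 := by
      apply le_antisymm
      · refine Multiset.sup_le.2 fun i hi => ?_
        rw [hparts, Multiset.mem_add, Finset.mem_val, mem_Icc] at hi
        rcases hi with h | h
        · exact (m.2 i h).2
        · exact h.2
      · refine le_largestPart_s17 _ ?_
        rw [hparts, Multiset.mem_add, Finset.mem_val, mem_Icc]
        exact Or.inr ⟨hj.2, le_rfl⟩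
    have hsub : Icc j (L + 1) ⊆ (g m).2.parts.toFinset := by
      intro i hi
      rw [hparts, Multiset.mem_toFinset, Multiset.mem_add]
      exact Or.inr hi
    have hsum : (g m).1 = m.1.sum + ∑ i ∈ Icc j (L + 1), i := by
      change (m.1 + (Icc j (L + 1)).val).sum = _
      rw [Multiset.sum_add, Finset.sum_val]
      rfl
    rw [if_pos ⟨hlarge, hsub⟩, one_mul, hsum, pow_add, mul_comm]
  · intro σ hσ
    rw [Function.mem_support] at hσ
    have hc : largestPart σ.2 = L + 1 ∧ Icc j (L + 1) ⊆ σ.2.parts.toFinset := by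
      by_contra h
      exact hσ (by rw [if_neg h, zero_mul])
    have hle : (Icc j (L + 1)).val ≤ σ.2.parts := by
      rw [Multiset.le_iff_subset (Icc j (L + 1)).nodup]
      exact fun i hi => Multiset.mem_toFinset.1 (hc.2 hi)
    refine ⟨⟨σ.2.parts - (Icc j (L + 1)).val, fun i hi => ?_⟩, hext _ _ ?_⟩
    · have hi' := Multiset.mem_of_le (Multiset.sub_le_self _ _) hi
      exact ⟨σ.2.parts_pos hi', hc.1 ▸ le_largestPart_s17 _ hi'⟩
    · rw [hparts]
      exact Multiset.sub_add_cancel hle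

theorem sigmaMaex_le_sigmaL (n : ℕ) : sigmaMaex n ≤ sigmaL n :=
  Finset.sum_le_sum fun π _ => maex_le_largestPart π

theorem sigmaL_sub_sigmaMaex (n : ℕ) :
    sigmaL n - sigmaMaex n = ∑ π : n.Partition, (largestPart π - maex π) :=
  (Finset.sum_tsub_distrib _ fun π _ => maex_le_largestPart π).symm

theorem sigmaL_sub_sigmaMaex_zero : sigmaL 0 - sigmaMaex 0 = 0 := by
  rw [sigmaL_sub_sigmaMaex]
  refine sum_eq_zero fun π _ => ?_
  simp [largestPart, Subsingleton.elim π (Nat.Partition.indiscrete 0)]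

theorem tsum_sigmaL_sub_sigmaMaex (x : ENNReal) :
    ∑' n : ℕ, ((sigmaL (n + 1) - sigmaMaex (n + 1) : ℕ) : ENNReal) * x ^ (n + 1) =
      ∑' L : ℕ, (∑ j ∈ Icc 1 (L + 1), x ^ (∑ i ∈ Icc j (L + 1), i)) *
        ∏ i ∈ range (L + 1), (1 - x ^ (i + 1))⁻¹ := by
  have h0 : ∑' n : ℕ, ((sigmaL (n + 1) - sigmaMaex (n + 1) : ℕ) : ENNReal) * x ^ (n + 1) =
      ∑' n : ℕ, ((sigmaL n - sigmaMaex n : ℕ) : ENNReal) * x ^ n := by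
    rw [tsum_eq_zero_add' (f := fun n => ((sigmaL n - sigmaMaex n : ℕ) : ENNReal) * x ^ n)
      ENNReal.summable, sigmaL_sub_sigmaMaex_zero]
    simp
  have h1 : ∑' n : ℕ, ((sigmaL n - sigmaMaex n : ℕ) : ENNReal) * x ^ n =
      ∑' σ : Σ n : ℕ, n.Partition, ((largestPart σ.2 - maex σ.2 : ℕ) : ENNReal) * x ^ σ.1 := by
    refine Eq.trans ?_ (ENNReal.tsum_sigma fun (n : ℕ) (p : n.Partition) =>
      ((largestPart p - maex p : ℕ) : ENNReal) * x ^ n).symm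
    refine tsum_congr fun n => ?_
    rw [sigmaL_sub_sigmaMaex, tsum_fintype, Nat.cast_sum, Finset.sum_mul]
  rw [h0, h1]
  simp_rw [natCast_largestPart_sub_maex, ← ENNReal.tsum_mul_right, Finset.sum_mul]
  rw [ENNReal.tsum_comm]
  refine tsum_congr fun L => ?_
  rw [Summable.tsum_finsetSum fun _ _ => ENNReal.summable]
  refine sum_congr rfl fun j hj => ?_
  rw [tsum_partition_Icc_subset x hj, boundedGenFun_eq_prod]

open Filter Real

/-- The Euler function `∏ (1 - q ^ n)`, `n ≥ 1`, of a real variable. -/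
def eulerProd (q : ℝ) : ℝ := ∏' n : ℕ, (1 - q ^ (n + 1))

/-- The sum of `q ^ (j + ⋯ + M)` over `1 ≤ j ≤ M`. -/
def runSum (q : ℝ) : ℕ → ℝ
  | 0 => 0
  | M + 1 => q ^ (M + 1) * (1 + runSum q M)

theorem sum_pow_sum_Icc_eq_runSum (q : ℝ) (M : ℕ) :
    ∑ j ∈ Icc 1 M, q ^ (∑ i ∈ Icc j M, i) = runSum q M := by
  induction M with
  | zero => simp [runSum]
  | succ M ih =>
    rw [Finset.sum_Icc_succ_top (by omega), runSum, ← ih, mul_add, mul_sum, add_comm]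
    congr 1
    · simp
    · refine sum_congr rfl fun j hj => ?_
      rw [mem_Icc] at hj
      rw [Finset.sum_Icc_succ_top (by omega), pow_add, mul_comm]

section

variable {q : ℝ}

theorem runSum_nonneg (h0 : 0 < q) (M : ℕ) : 0 ≤ runSum q M := by
  induction M with
  | zero => simp [runSum]
  | succ M ih => rw [runSum]; positivity

theorem runSum_le (h0 : 0 < q) (h1 : q < 1) (M : ℕ) : runSum q M ≤ 1 / (1 - q) := by
  have hq : 0 < 1 - q := by linarith
  induction M with
  | zero => rw [runSum]; positivity
  | succ M ih =>
    have hp : q ^ (M + 1) ≤ q := pow_le_of_le_one h0.le h1.le (by omega)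
    have := runSum_nonneg h0 M
    calc runSum q (M + 1) ≤ q * (1 + 1 / (1 - q)) := by rw [runSum]; gcongr
      _ ≤ 1 / (1 - q) := by
        rw [le_div_iff₀ hq]
        field_simp
        nlinarith [sq_nonneg (1 - q)]

theorem runSum_succ_le (h0 : 0 < q) (h1 : q < 1) (M : ℕ) :
    runSum q (M + 1) ≤ q ^ (M + 1) + q ^ (2 * M + 1) + q ^ (3 * M) * (2 / (1 - q)) := by
  have hq : 0 < 1 - q := by linarith
  match M with
  | 0 =>
    simp only [runSum]
    have : 0 ≤ 2 / (1 - q) := by positivity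
    simp
    linarith
  | 1 =>
    simp only [runSum]
    have : 0 ≤ q ^ 3 * (2 / (1 - q)) := by positivity
    norm_num
    nlinarith
  | M + 2 =>
    have h := runSum_le h0 h1 M
    have h2 : 1 + 1 / (1 - q) ≤ 2 / (1 - q) := by
      rw [le_div_iff₀ hq]
      field_simp
      linarith
    have h3 : 1 + runSum q M ≤ 2 / (1 - q) := by linarith
    have h4 : q ^ (3 * (M + 2)) * (1 + runSum q M) ≤ q ^ (3 * (M + 2)) * (2 / (1 - q)) := by gcongr
    refine le_trans (le_of_eq ?_) (add_le_add_right h4 _)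
    simp only [runSum]
    ring

theorem multipliable_one_sub_pow_real (h0 : 0 < q) (h1 : q < 1) :
    Multipliable fun n : ℕ => 1 - q ^ (n + 1) := by
  have := Real.multipliable_one_add_of_summable (f := fun n : ℕ => -q ^ (n + 1))
    (((summable_nat_add_iff 1).mpr (summable_geometric_of_lt_one h0.le h1)).neg)
  simpa [sub_eq_add_neg] using this

theorem one_sub_pow_succ_pos (h0 : 0 < q) (h1 : q < 1) (n : ℕ) : 0 < 1 - q ^ (n + 1) :=
  sub_pos.2 (pow_lt_one₀ h0.le h1 (by omega))

theorem ofReal_eulerProd (h0 : 0 < q) (h1 : q < 1) :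
    (eulerProd q : ℂ) = ∏' n : ℕ, (1 - (q : ℂ) ^ (n + 1)) := by
  have := (multipliable_one_sub_pow_real h0 h1).map_tprod Complex.ofRealHom Complex.continuous_ofReal
  simpa [eulerProd] using this

theorem eulerProd_ne_zero (h0 : 0 < q) (h1 : q < 1) : eulerProd q ≠ 0 := by
  have := tprod_one_add_ne_zero_of_summable (f := fun n : ℕ => -q ^ (n + 1))
    (fun n => by simpa [← sub_eq_add_neg] using (one_sub_pow_succ_pos h0 h1 n).ne')
    (by simpa [abs_of_pos h0] using
      (summable_nat_add_iff 1).mpr (summable_geometric_of_lt_one h0.le h1))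
  simpa [eulerProd, sub_eq_add_neg] using this

theorem tendsto_prod_eulerProd (h0 : 0 < q) (h1 : q < 1) :
    Tendsto (fun L => ∏ i ∈ range L, (1 - q ^ (i + 1))) atTop (nhds (eulerProd q)) :=
  (multipliable_one_sub_pow_real h0 h1).hasProd.tendsto_prod_nat

theorem eulerProd_pos (h0 : 0 < q) (h1 : q < 1) : 0 < eulerProd q :=
  (ge_of_tendsto' (tendsto_prod_eulerProd h0 h1) fun _ =>
    prod_nonneg fun i _ => (one_sub_pow_succ_pos h0 h1 i).le).lt_of_ne
      (eulerProd_ne_zero h0 h1).symm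

/-- The tail product `∏ (1 - q ^ n)` over `n > L`. -/
def eulerTail (q : ℝ) (L : ℕ) : ℝ := eulerProd q * ∏ i ∈ range L, (1 - q ^ (i + 1))⁻¹

theorem eulerTail_zero : eulerTail q 0 = eulerProd q := by simp [eulerTail]

theorem eulerTail_pos (h0 : 0 < q) (h1 : q < 1) (L : ℕ) : 0 < eulerTail q L :=
  mul_pos (eulerProd_pos h0 h1) (prod_pos fun i _ => inv_pos.2 (one_sub_pow_succ_pos h0 h1 i))

theorem eulerTail_eq_mul_succ (h0 : 0 < q) (h1 : q < 1) (L : ℕ) :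
    eulerTail q L = (1 - q ^ (L + 1)) * eulerTail q (L + 1) := by
  have := (one_sub_pow_succ_pos h0 h1 L).ne'
  rw [eulerTail, eulerTail, prod_range_succ]
  field_simp

theorem tendsto_eulerTail (h0 : 0 < q) (h1 : q < 1) :
    Tendsto (eulerTail q) atTop (nhds 1) := by
  have h := ((tendsto_prod_eulerProd h0 h1).inv₀ (eulerProd_ne_zero h0 h1)).const_mul (eulerProd q)
  rw [mul_inv_cancel₀ (eulerProd_ne_zero h0 h1)] at h
  refine h.congr fun L => ?_
  rw [eulerTail, prod_inv_distrib]

theorem eulerTail_le_one (h0 : 0 < q) (h1 : q < 1) (L : ℕ) : eulerTail q L ≤ 1 := by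
  refine (monotone_nat_of_le_succ fun n => ?_).ge_of_tendsto (tendsto_eulerTail h0 h1) L
  rw [eulerTail_eq_mul_succ h0 h1 n]
  have := eulerTail_pos h0 h1 (n + 1)
  have : 0 < q ^ (n + 1) := by positivity
  nlinarith

theorem eulerProd_le (h0 : 0 < q) (h1 : q < 1) : eulerProd q ≤ 1 - q := by
  rw [← eulerTail_zero, eulerTail_eq_mul_succ h0 h1 0]
  have := eulerTail_le_one h0 h1 1
  simp only [zero_add, pow_one]
  nlinarith

theorem summable_pow_mul_eulerTail (h0 : 0 < q) (h1 : q < 1) (k : ℕ) (hk : 0 < k) :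
    Summable fun L : ℕ => q ^ (k * (L + 1)) * eulerTail q (L + 1) := by
  refine Summable.of_nonneg_of_le (fun L => ?_) (fun L => ?_)
    ((summable_nat_add_iff 1).mpr (summable_geometric_of_lt_one h0.le h1))
  · have := eulerTail_pos h0 h1 (L + 1)
    positivity
  · calc q ^ (k * (L + 1)) * eulerTail q (L + 1) ≤ q ^ (L + 1) * 1 := by
          refine mul_le_mul ?_ (eulerTail_le_one h0 h1 _) (eulerTail_pos h0 h1 _).le (by positivity)
          exact pow_le_pow_of_le_one h0.le h1.le (Nat.le_mul_of_pos_left _ hk)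
      _ = q ^ (L + 1) := mul_one _

/-- The `k`-th moment of the tail products. -/
def eulerMoment (q : ℝ) (k : ℕ) : ℝ := ∑' L : ℕ, q ^ (k * (L + 1)) * eulerTail q (L + 1)

theorem eulerMoment_one (h0 : 0 < q) (h1 : q < 1) : eulerMoment q 1 = 1 - eulerProd q := by
  have hs := (summable_pow_mul_eulerTail h0 h1 1 one_pos).hasSum.tendsto_sum_nat
  refine tendsto_nhds_unique hs ?_
  rw [← eulerTail_zero]
  refine ((tendsto_eulerTail h0 h1).sub_const (eulerTail q 0)).congr fun N => ?_
  rw [← sum_range_sub (eulerTail q)]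
  refine sum_congr rfl fun L _ => ?_
  rw [eulerTail_eq_mul_succ h0 h1 L]
  ring

theorem eulerMoment_succ_le (h0 : 0 < q) (h1 : q < 1) (k : ℕ) (hk : 0 < k) :
    eulerMoment q (k + 1) ≤ (1 - q ^ k) * eulerMoment q k := by
  have hs := summable_pow_mul_eulerTail h0 h1 k hk
  have hs' := summable_pow_mul_eulerTail h0 h1 (k + 1) (by omega)
  have hd : (fun L : ℕ => q ^ (k * (L + 1)) * eulerTail q (L + 1) -
      q ^ ((k + 1) * (L + 1)) * eulerTail q (L + 1)) =
      fun L : ℕ => q ^ (k * (L + 1)) * eulerTail q L := by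
    funext L
    rw [eulerTail_eq_mul_succ h0 h1 L]
    ring
  have h2 : eulerMoment q k - eulerMoment q (k + 1) =
      ∑' L : ℕ, q ^ (k * (L + 1)) * eulerTail q L := by
    rw [eulerMoment, eulerMoment, ← hs.tsum_sub hs', hd]
  have hs'' : Summable fun L : ℕ => q ^ (k * (L + 1)) * eulerTail q L := hd ▸ hs.sub hs'
  rw [hs''.tsum_eq_zero_add] at h2
  have h3 : ∑' L : ℕ, q ^ (k * (L + 1 + 1)) * eulerTail q (L + 1) = q ^ k * eulerMoment q k := by
    rw [eulerMoment, ← tsum_mul_left]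
    refine tsum_congr fun L => ?_
    ring
  rw [h3] at h2
  have h4 : 0 < q ^ (k * (0 + 1)) * eulerTail q 0 := by
    have := eulerTail_pos h0 h1 0
    positivity
  linarith

theorem tsum_runSum_mul_eulerTail_bounds (h0 : 0 < q) (h1 : q < 1) :
    q ≤ ∑' L : ℕ, runSum q (L + 1) * eulerTail q (L + 1) ∧
      ∑' L : ℕ, runSum q (L + 1) * eulerTail q (L + 1) ≤
        1 + (1 - q) / q + 2 * (1 - q ^ 2) / q ^ 3 := by
  have hq : 0 < 1 - q := by linarith
  have s1 := summable_pow_mul_eulerTail h0 h1 1 (by omega)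
  have s2 := (summable_pow_mul_eulerTail h0 h1 2 (by omega)).mul_left q⁻¹
  have s3 := (summable_pow_mul_eulerTail h0 h1 3 (by omega)).mul_left (2 / (1 - q) * (q ^ 3)⁻¹)
  have hle : ∀ L : ℕ, runSum q (L + 1) * eulerTail q (L + 1) ≤
      q ^ (1 * (L + 1)) * eulerTail q (L + 1) +
        q⁻¹ * (q ^ (2 * (L + 1)) * eulerTail q (L + 1)) +
        2 / (1 - q) * (q ^ 3)⁻¹ * (q ^ (3 * (L + 1)) * eulerTail q (L + 1)) := by
    intro L
    refine (mul_le_mul_of_nonneg_right (runSum_succ_le h0 h1 L) (eulerTail_pos h0 h1 _).le).trans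
      (le_of_eq ?_)
    have e2 : q ^ (2 * (L + 1)) = q * q ^ (2 * L + 1) := by ring
    have e3 : q ^ (3 * (L + 1)) = q ^ 3 * q ^ (3 * L) := by ring
    rw [e2, e3, one_mul]
    field_simp
  have hnn : ∀ L : ℕ, 0 ≤ runSum q (L + 1) * eulerTail q (L + 1) := fun L =>
    mul_nonneg (runSum_nonneg h0 _) (eulerTail_pos h0 h1 _).le
  have hs := Summable.of_nonneg_of_le hnn hle ((s1.add s2).add s3)
  have hE_pos := eulerProd_pos h0 h1
  have hE_le := eulerProd_le h0 h1
  have m1 := eulerMoment_one h0 h1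
  refine ⟨?_, ?_⟩
  · have : eulerMoment q 1 ≤ ∑' L : ℕ, runSum q (L + 1) * eulerTail q (L + 1) := by
      refine s1.tsum_le_tsum (fun L => ?_) hs
      refine mul_le_mul_of_nonneg_right ?_ (eulerTail_pos h0 h1 _).le
      have := mul_nonneg (pow_pos h0 (L + 1)).le (runSum_nonneg h0 L)
      rw [runSum, one_mul]
      linarith
    linarith
  · have h := hs.tsum_le_tsum hle ((s1.add s2).add s3)
    rw [(s1.add s2).tsum_add s3, s1.tsum_add s2, tsum_mul_left, tsum_mul_left] at h
    change _ ≤ eulerMoment q 1 + q⁻¹ * eulerMoment q 2 +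
      2 / (1 - q) * (q ^ 3)⁻¹ * eulerMoment q 3 at h
    have m2 : eulerMoment q 2 ≤ 1 - q := by
      have := eulerMoment_succ_le h0 h1 1 one_pos
      rw [m1, pow_one] at this
      nlinarith
    have m3 : eulerMoment q 3 ≤ (1 - q ^ 2) * (1 - q) := by
      have h' := eulerMoment_succ_le h0 h1 2 two_pos
      have : 0 ≤ 1 - q ^ 2 := (one_sub_pow_succ_pos h0 h1 1).le
      exact h'.trans (by gcongr)
    calc _ ≤ _ := h
      _ ≤ 1 + q⁻¹ * (1 - q) + 2 / (1 - q) * (q ^ 3)⁻¹ * ((1 - q ^ 2) * (1 - q)) := by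
        gcongr
        linarith
      _ = _ := by field_simp

end

theorem exp_neg_lt_one {t : ℝ} (ht : 0 < t) : Real.exp (-t) < 1 :=
  Real.exp_lt_one_iff.2 (neg_lt_zero.2 ht)

open Complex in
theorem norm_eta_I_mul {s : ℝ} (hs : 0 < s) :
    ‖ModularForm.eta (I * s)‖ = Real.exp (-(π * s / 12)) * eulerProd (Real.exp (-(2 * π * s))) := by
  have hq0 := Real.exp_pos (-(2 * π * s))
  have hq1 : Real.exp (-(2 * π * s)) < 1 := exp_neg_lt_one (by positivity)
  have hprod : ∏' n, (1 - ModularForm.eta_q n (I * s)) =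
      (eulerProd (Real.exp (-(2 * π * s))) : ℂ) := by
    rw [ofReal_eulerProd hq0 hq1]
    refine tprod_congr fun n => ?_
    rw [ModularForm.eta_q_eq_pow, ofReal_exp]
    congr 3
    push_cast
    linear_combination (2 * π * s : ℂ) * I_mul_I
  rw [ModularForm.eta, hprod, norm_mul, norm_real, Real.norm_of_nonneg (eulerProd_pos hq0 hq1).le]
  congr 1
  rw [Function.Periodic.qParam, norm_exp]
  congr 1
  have : 2 * (π : ℂ) * I * (I * s) / (24 : ℝ) = ((-(π * s / 12) : ℝ) : ℂ) := by
    push_cast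
    linear_combination (2 * π * s / 24 : ℂ) * I_mul_I
  rw [this, ofReal_re]

theorem norm_sqrt_eq (z : ℂ) : ‖Complex.sqrt z‖ = Real.sqrt ‖z‖ := by
  have h := Complex.norm_cpow_real z 2⁻¹
  push_cast at h
  rw [Complex.sqrt, h, Real.sqrt_eq_rpow, one_div]

open Complex in
theorem norm_eta_I_mul_inv {s : ℝ} (hs : 0 < s) :
    ‖ModularForm.eta (I * (s⁻¹ : ℝ))‖ = Real.sqrt s * ‖ModularForm.eta (I * s)‖ := by
  have h := ModularForm.eta_comp_eq_csqrt_I_inv (x := I * s)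
    (show 0 < (I * s : ℂ).im by simpa using hs)
  have e : (-1 / (I * s) : ℂ) = I * (s⁻¹ : ℝ) := by
    have : (s : ℂ) ≠ 0 := ofReal_ne_zero.2 hs.ne'
    push_cast
    field_simp
    simp
  have hI : ‖Complex.sqrt I‖ = 1 := by
    rw [norm_sqrt_eq, norm_I, Real.sqrt_one]
  have hIs : ‖Complex.sqrt (I * s)‖ = Real.sqrt s := by
    rw [norm_sqrt_eq, norm_mul, norm_I, one_mul, norm_real, Real.norm_of_nonneg hs.le]
  simp only [Function.comp_apply, e, Pi.smul_apply, Pi.mul_apply, smul_eq_mul] at h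
  rw [h, norm_mul, norm_mul, norm_inv, hI, hIs]
  simp

theorem eulerProd_exp_neg_mul {t : ℝ} (ht : 0 < t) :
    eulerProd (Real.exp (-t)) * (Real.sqrt (t / (2 * π)) * Real.exp (π ^ 2 / (6 * t))) =
      Real.exp (t / 24) * eulerProd (Real.exp (-(4 * π ^ 2 / t))) := by
  have hpi := pi_pos
  have hs : 0 < t / (2 * π) := by positivity
  have h := norm_eta_I_mul_inv hs
  rw [norm_eta_I_mul hs, norm_eta_I_mul (inv_pos.2 hs)] at h
  have e1 : π * (t / (2 * π)) / 12 = t / 24 := by field_simp; norm_num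
  have e2 : 2 * π * (t / (2 * π)) = t := by field_simp
  have e3 : π * (t / (2 * π))⁻¹ / 12 = π ^ 2 / (6 * t) := by field_simp; norm_num
  have e4 : 2 * π * (t / (2 * π))⁻¹ = 4 * π ^ 2 / t := by field_simp; norm_num
  rw [e1, e2, e3, e4, Real.exp_neg, Real.exp_neg (t / 24)] at h
  have := Real.exp_pos (t / 24)
  have := Real.exp_pos (π ^ 2 / (6 * t))
  field_simp at h ⊢
  linarith

theorem tendsto_eulerProd_nhdsGT_zero :
    Tendsto eulerProd (nhdsWithin 0 (Set.Ioi 0)) (nhds 1) := by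
  have hd := (ModularForm.differentiableOn_tprod_one_sub_pow.continuousOn.continuousAt
    (Metric.ball_mem_nhds (0 : ℂ) one_pos)).tendsto
  simp only [ne_eq, Nat.add_eq_zero_iff, one_ne_zero, and_false, not_false_eq_true, zero_pow,
    sub_zero, tprod_one] at hd
  have hc : Tendsto (fun q : ℝ => (q : ℂ)) (nhdsWithin 0 (Set.Ioi 0)) (nhds 0) :=
    (Complex.continuous_ofReal.tendsto' 0 0 (by simp)).mono_left nhdsWithin_le_nhds
  have h := (hd.comp hc).norm
  rw [norm_one] at h
  refine h.congr' ?_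
  filter_upwards [Ioo_mem_nhdsGT (zero_lt_one' ℝ)] with q hq
  rw [Function.comp_apply, ← ofReal_eulerProd hq.1 hq.2, Complex.norm_real,
    Real.norm_of_nonneg (eulerProd_pos hq.1 hq.2).le]

theorem tendsto_eulerProd_exp_neg_mul :
    Tendsto (fun t : ℝ => eulerProd (Real.exp (-t)) *
      (Real.sqrt (t / (2 * π)) * Real.exp (π ^ 2 / (6 * t))))
      (nhdsWithin 0 (Set.Ioi 0)) (nhds 1) := by
  have h1 : Tendsto (fun t : ℝ => Real.exp (t / 24)) (nhdsWithin 0 (Set.Ioi 0)) (nhds 1) :=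
    (Continuous.tendsto' (by fun_prop) 0 1 (by simp)).mono_left nhdsWithin_le_nhds
  have h2 : Tendsto (fun t : ℝ => Real.exp (-(4 * π ^ 2 / t))) (nhdsWithin 0 (Set.Ioi 0))
      (nhdsWithin 0 (Set.Ioi 0)) := by
    refine tendsto_nhdsWithin_iff.2 ⟨?_, Eventually.of_forall fun t => Real.exp_pos _⟩
    have h : Tendsto (fun t : ℝ => 4 * π ^ 2 / t) (nhdsWithin 0 (Set.Ioi 0)) atTop := by
      simp only [div_eq_mul_inv]
      exact tendsto_inv_nhdsGT_zero.const_mul_atTop (by have := pi_pos; positivity)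
    exact Real.tendsto_exp_neg_atTop_nhds_zero.comp h
  have h := h1.mul (tendsto_eulerProd_nhdsGT_zero.comp h2)
  rw [one_mul] at h
  refine h.congr' ?_
  filter_upwards [self_mem_nhdsWithin] with t ht
  exact (eulerProd_exp_neg_mul ht).symm

theorem eulerProd_mul_tsum_sigmaL_sub_sigmaMaex {t : ℝ} (ht : 0 < t) :
    eulerProd (Real.exp (-t)) *
      (∑' n : ℕ, (((sigmaL (n + 1) : ℤ) - (sigmaMaex (n + 1) : ℤ) : ℤ) : ℝ) *
        Real.exp (-((n : ℝ) + 1) * t)) =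
      ∑' L : ℕ, runSum (Real.exp (-t)) (L + 1) * eulerTail (Real.exp (-t)) (L + 1) := by
  set q := Real.exp (-t) with hq
  have h0 : 0 < q := Real.exp_pos _
  have h1 : q < 1 := exp_neg_lt_one ht
  have hterm : ∀ n : ℕ, (((sigmaL (n + 1) : ℤ) - (sigmaMaex (n + 1) : ℤ) : ℤ) : ℝ) *
      Real.exp (-((n : ℝ) + 1) * t) =
      (((sigmaL (n + 1) - sigmaMaex (n + 1) : ℕ) : ENNReal) *
        ENNReal.ofReal q ^ (n + 1)).toReal := by
    intro n
    rw [ENNReal.toReal_mul, ENNReal.toReal_natCast, ENNReal.toReal_pow,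
      ENNReal.toReal_ofReal h0.le, Nat.cast_sub (sigmaMaex_le_sigmaL _), hq, ← Real.exp_nat_mul]
    push_cast
    congr 2
    ring
  have hprod : ∀ L : ℕ, ∏ i ∈ range L, (1 - ENNReal.ofReal q ^ (i + 1))⁻¹ =
      ENNReal.ofReal (∏ i ∈ range L, (1 - q ^ (i + 1))⁻¹) := by
    intro L
    rw [ENNReal.ofReal_prod_of_nonneg fun i _ => (inv_pos.2 (one_sub_pow_succ_pos h0 h1 i)).le]
    refine prod_congr rfl fun i _ => ?_
    rw [ENNReal.ofReal_inv_of_pos (one_sub_pow_succ_pos h0 h1 i),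
      ENNReal.ofReal_sub _ (by positivity), ENNReal.ofReal_one, ENNReal.ofReal_pow h0.le]
  have hrun : ∀ L : ℕ, ∑ j ∈ Icc 1 L, ENNReal.ofReal q ^ (∑ i ∈ Icc j L, i) =
      ENNReal.ofReal (runSum q L) := by
    intro L
    rw [← sum_pow_sum_Icc_eq_runSum, ENNReal.ofReal_sum_of_nonneg fun j _ => by positivity]
    exact sum_congr rfl fun j _ => (ENNReal.ofReal_pow h0.le _).symm
  rw [tsum_congr hterm, ← ENNReal.tsum_toReal_eq fun n =>
    ENNReal.mul_ne_top (by simp) (by simp), tsum_sigmaL_sub_sigmaMaex]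
  rw [ENNReal.tsum_toReal_eq, ← tsum_mul_left]
  · refine tsum_congr fun L => ?_
    rw [hrun, hprod, ENNReal.toReal_mul, ENNReal.toReal_ofReal (runSum_nonneg h0 _),
      ENNReal.toReal_ofReal (prod_nonneg fun i _ => (inv_pos.2 (one_sub_pow_succ_pos h0 h1 i)).le),
      eulerTail]
    ring
  · intro L
    rw [hrun, hprod]
    exact ENNReal.mul_ne_top ENNReal.ofReal_ne_top ENNReal.ofReal_ne_top

theorem tendsto_eulerProd_mul_tsum :
    Tendsto (fun t : ℝ => eulerProd (Real.exp (-t)) *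
      (∑' n : ℕ, (((sigmaL (n + 1) : ℤ) - (sigmaMaex (n + 1) : ℤ) : ℤ) : ℝ) *
        Real.exp (-((n : ℝ) + 1) * t))) (nhdsWithin 0 (Set.Ioi 0)) (nhds 1) := by
  have hexp : Tendsto (fun t : ℝ => Real.exp (-t)) (nhdsWithin 0 (Set.Ioi 0)) (nhds 1) :=
    (Continuous.tendsto' (by fun_prop) 0 1 (by simp)).mono_left nhdsWithin_le_nhds
  have hup : Tendsto (fun q : ℝ => 1 + (1 - q) / q + 2 * (1 - q ^ 2) / q ^ 3) (nhds 1) (nhds 1) := by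
    have : ContinuousAt (fun q : ℝ => 1 + (1 - q) / q + 2 * (1 - q ^ 2) / q ^ 3) 1 := by
      fun_prop (disch := norm_num)
    simpa [ContinuousAt] using this
  refine tendsto_of_tendsto_of_tendsto_of_le_of_le' hexp (hup.comp hexp) ?_ ?_
  all_goals
    filter_upwards [self_mem_nhdsWithin] with t ht
    have hb := tsum_runSum_mul_eulerTail_bounds (Real.exp_pos (-t))
      (exp_neg_lt_one ht)
    rw [eulerProd_mul_tsum_sigmaL_sub_sigmaMaex ht]
  · exact hb.1
  · exact hb.2

/-- As `t → 0⁺`,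
`∑_{n≥1} (σL(n) − σmaex(n)) e^{−nt} ∼ √(t/(2π)) e^{π²/(6t)}`, i.e. their ratio tends
to `1` (the sum over `n ≥ 1` is written with `n` reindexed as `n+1`, `n ≥ 0`). -/
theorem sum_exp_asymptotic :
    Tendsto (fun t : ℝ =>
        (∑' n : ℕ, (((sigmaL (n + 1) : ℤ) - (sigmaMaex (n + 1) : ℤ) : ℤ) : ℝ) *
            Real.exp (-((n : ℝ) + 1) * t)) /
          (Real.sqrt (t / (2 * π)) * Real.exp (π ^ 2 / (6 * t))))
      (nhdsWithin 0 (Set.Ioi 0)) (nhds 1) := by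
  have h := tendsto_eulerProd_mul_tsum.div tendsto_eulerProd_exp_neg_mul one_ne_zero
  rw [div_one] at h
  refine h.congr' ?_
  filter_upwards [self_mem_nhdsWithin] with t ht
  exact mul_div_mul_left _ _ (eulerProd_ne_zero (Real.exp_pos (-t)) (exp_neg_lt_one ht))
end
end
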